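/- arXiv:2409.18230 — 4 statements merged into one kernel-verified Lean document; each statement's English description precedes it below -/
import Mathlib

section
/- For every r with 1 < r < ∞, there exists a measurable weight w : [0,1) → (0,∞), with w and w^r integrable on [0,1), such that for every integer n ≥ 2 both of the following hold: (i) the measure μ(E) = ∫_E w dx is n-adic doubling on [0,1) (there is a constant C₀(n) with μ(J₁) ≤ C₀(n)·μ(J₂) for all n-adic siblings J₁, J₂ ⊆ [0,1)); and (ii) there is a constant C(n) with (⨍_J w^r)^{1/r} ≤ C(n)·(⨍_J w) for every n-adic interval J ⊆ [0,1); yet there is no constant C such that (⨍_I w^r)^{1/r} ≤ C·(⨍_I w) holds for all intervals I ⊆ [0,1) of positive length. In particular, the intersection over all n ≥ 2 of the n-adic reverse Hölder-r classes RH_r^n (whose members are additionally required to be n-adic doubling) is strictly larger than the full reverse Hölder class RH_r permits, i.e., ∩_{n≥2} RH_r^n ⊊ RH_r. -/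
open MeasureTheory Set
open scoped ENNReal

/-- The `n`-adic interval `[(k-1)/n^m, k/n^m)` (of length `n^{-m}`). -/
def nadicI (n : ℕ) (m k : ℤ) : Set ℝ :=
  Set.Ico ((k - 1 : ℝ) / (n : ℝ) ^ m) ((k : ℝ) / (n : ℝ) ^ m)

/-- `J₁` and `J₂` are `n`-adic siblings: both are `n`-adic intervals of length
`n^{-(m+1)}` contained in a common `n`-adic interval of length `n^{-m}`. -/
def NAdicSiblings (n : ℕ) (J₁ J₂ : Set ℝ) : Prop :=
  ∃ m k₁ k₂ k : ℤ, J₁ = nadicI n (m + 1) k₁ ∧ J₂ = nadicI n (m + 1) k₂ ∧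
    J₁ ⊆ nadicI n m k ∧ J₂ ⊆ nadicI n m k

/-- `I₁, I₂` are adjacent half-open intervals of equal positive length. -/
def AdjacentPair (I₁ I₂ : Set ℝ) : Prop :=
  ∃ x l : ℝ, 0 < l ∧
    ((I₁ = Set.Ico (x - l) x ∧ I₂ = Set.Ico x (x + l)) ∨
     (I₂ = Set.Ico (x - l) x ∧ I₁ = Set.Ico x (x + l)))

lemma exists_simultaneous_approx (N : ℕ) (δ : ℝ) (hδ : 0 < δ) :
    ∃ k : ℕ, N ≤ k ∧ ∀ n : ℕ, 2 ≤ n → n < N →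
      ∃ m : ℤ, |(n : ℝ) ^ (-m) * 16 ^ k - 1| < δ := by
  obtain ⟨η, hη, hexp⟩ :=
    Metric.continuousAt_iff.1 (Real.continuous_exp.continuousAt (x := 0)) δ hδ
  have hL : 0 < Real.log (N + 2) := Real.log_pos (by linarith [N.cast_nonneg (α := ℝ)])
  let g : ℕ → UnitAddCircle := fun n => ((Real.log 16 / Real.log n : ℝ) : UnitAddCircle)
  have hU : (Finset.range N : Set ℕ).pi (fun _ => Metric.ball (0 : UnitAddCircle)
      (η / Real.log (N + 2))) ∈ nhds (0 : ℕ → UnitAddCircle) :=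
    set_pi_mem_nhds (Finset.finite_toSet _) fun _ _ => Metric.ball_mem_nhds _ (div_pos hη hL)
  obtain ⟨k, hk, hkU⟩ := Filter.frequently_atTop.1
    ((mapClusterPt_zero_atTop_nsmul g).frequently hU) N
  refine ⟨k, hk, fun n hn hnN => ⟨round (k * (Real.log 16 / Real.log n)), ?_⟩⟩
  have h := hkU n (by simpa using hnN)
  have hn0 : (0 : ℝ) < n := by positivity
  have hlog : 0 < Real.log n := Real.log_pos (by exact_mod_cast hn)
  have hlog' : Real.log n ≤ Real.log (N + 2) := by
    have : (n : ℝ) ≤ N := by exact_mod_cast hnN.le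
    gcongr; linarith
  simp only [Pi.smul_apply, g, ← AddCircle.coe_nsmul, mem_ball_zero_iff, nsmul_eq_mul,
    UnitAddCircle.norm_eq, lt_div_iff₀ hL] at h
  set m := round (k * (Real.log 16 / Real.log n))
  have key : (n : ℝ) ^ (-m) * 16 ^ k =
      Real.exp ((k * (Real.log 16 / Real.log n) - m) * Real.log n) := by
    rw [← Real.rpow_intCast, ← Real.rpow_natCast, Real.rpow_def_of_pos hn0,
      Real.rpow_def_of_pos (by norm_num), ← Real.exp_add]
    congr 1
    push_cast
    field_simp
    ring
  rw [key]
  have := @hexp ((k * (Real.log 16 / Real.log n) - m) * Real.log n) (by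
    rw [Real.dist_eq, sub_zero, abs_mul, abs_of_pos hlog]
    exact lt_of_le_of_lt (by gcongr) h)
  rwa [Real.dist_eq, Real.exp_zero] at this

lemma exists_heights : ∃ G : ℕ → ℕ, (∀ k, 1 ≤ G k) ∧
    (∀ k n, 2 ≤ n → n < G k → ∃ m : ℤ, |(n : ℝ) ^ (-m) * 16 ^ k - 1| < 1 / (16 * (G k : ℝ) ^ 4)) ∧
    ∀ M : ℕ, ∃ k, 1 ≤ k ∧ M ≤ G k := by
  classical
  let P : ℕ → ℕ → Prop := fun k g => ∀ n, 2 ≤ n → n < g →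
    ∃ m : ℤ, |(n : ℝ) ^ (-m) * 16 ^ k - 1| < 1 / (16 * (g : ℝ) ^ 4)
  have hP1 : ∀ k, P k 1 := fun k n h1 h2 => by omega
  refine ⟨fun k => Nat.findGreatest (P k) (k + 1), fun k => ?_, fun k => ?_, fun M => ?_⟩
  · exact Nat.le_findGreatest (by omega) (hP1 k)
  · exact Nat.findGreatest_spec (P := P k) (m := 1) (by omega) (hP1 k)
  · obtain ⟨k, hk, h⟩ := exists_simultaneous_approx (M + 1) (1 / (16 * ((M + 1 : ℕ) : ℝ) ^ 4))
      (by positivity)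
    exact ⟨k, by omega, (Nat.le_succ M).trans (Nat.le_findGreatest (by omega) h)⟩

/-- The profile `a ↦ max 1 (min (G² a) a⁻¹)`, which peaks at `a = 1 / G` with value `G`. -/
noncomputable def bump (G a : ℝ) : ℝ := max 1 (min (G ^ 2 * a) (1 / a))

lemma one_le_bump (G a : ℝ) : 1 ≤ bump G a := le_max_left _ _

lemma bump_le {G : ℝ} (hG : 1 ≤ G) {a : ℝ} (ha : 0 ≤ a) : bump G a ≤ G := by
  refine max_le hG ?_
  rcases le_total (G * a) 1 with h | h
  · refine (min_le_left _ _).trans ?_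
    nlinarith
  · have : 0 < a := by
      rcases ha.eq_or_lt with rfl | h'
      · simp at h; linarith
      · exact h'
    refine (min_le_right _ _).trans ?_
    rw [div_le_iff₀ this]; exact h

lemma bump_eq_one_of_le {G a : ℝ} (h : G ^ 2 * a ≤ 1) : bump G a = 1 :=
  max_eq_left ((min_le_left _ _).trans h)

lemma bump_eq_one_of_ge {G a : ℝ} (h : 1 ≤ a) : bump G a = 1 :=
  max_eq_left ((min_le_right _ _).trans (by rw [div_le_one (by linarith)]; exact h))

lemma mul_bump_mono {G a b : ℝ} (ha : 0 < a) (hab : a ≤ b) : a * bump G a ≤ b * bump G b := by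
  have hb := ha.trans_le hab
  unfold bump
  rw [mul_max_of_nonneg _ _ ha.le, mul_max_of_nonneg _ _ hb.le, mul_min_of_nonneg _ _ ha.le,
    mul_min_of_nonneg _ _ hb.le, mul_one_div_cancel ha.ne', mul_one_div_cancel hb.ne']
  have : a * (G ^ 2 * a) ≤ b * (G ^ 2 * b) := by
    have := mul_le_mul hab hab ha.le hb.le
    nlinarith [sq_nonneg G]
  gcongr

lemma mul_bump_swap {G a b : ℝ} (ha : 0 < a) (hab : a ≤ b) : a * bump G b ≤ b * bump G a := by
  have hb := ha.trans_le hab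
  unfold bump
  rw [mul_max_of_nonneg _ _ ha.le, mul_max_of_nonneg _ _ hb.le, mul_min_of_nonneg _ _ ha.le,
    mul_min_of_nonneg _ _ hb.le]
  have h1 : a * (G ^ 2 * b) = b * (G ^ 2 * a) := by ring
  have h2 : a * (1 / b) ≤ b * (1 / a) := by gcongr
  rw [h1]
  gcongr

lemma measurable_bump (G : ℝ) : Measurable (bump G) := by
  unfold bump; fun_prop

/-- The base point of the spike attached to the point `E`. -/
noncomputable def spikeBase (G E : ℝ) : ℝ := E - E / (16 * G ^ 4)

/-- A function equal to `1` away from a spike of height `G` to the right of `spikeBase G E`,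
with inverse square root decay. -/
noncomputable def spike (G E x : ℝ) : ℝ := bump G √((x - spikeBase G E) / (E / 8))

lemma measurable_spike (G E : ℝ) : Measurable (spike G E) := by
  unfold spike; exact (measurable_bump G).comp (by fun_prop)

lemma spikeBase_ge {G E : ℝ} (hG : 1 ≤ G) (hE : 0 < E) : 15 / 16 * E ≤ spikeBase G E := by
  have : E / (16 * G ^ 4) ≤ E / 16 := by
    gcongr; nlinarith [one_le_pow₀ hG (n := 4)]
  unfold spikeBase; linarith

lemma spikeBase_le {G E : ℝ} (hE : 0 < E) : spikeBase G E ≤ E := by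
  have : 0 ≤ E / (16 * G ^ 4) := by positivity
  unfold spikeBase; linarith

lemma spike_eq_one_of_le {G E x : ℝ} (hG : 1 ≤ G) (hE : 0 < E)
    (h : x ≤ spikeBase G E + E / (8 * G ^ 4)) : spike G E x = 1 := by
  refine bump_eq_one_of_le ?_
  have hG0 : 0 < G := by linarith
  have : √((x - spikeBase G E) / (E / 8)) ≤ 1 / G ^ 2 := by
    rw [Real.sqrt_le_left (by positivity), div_le_iff₀ (by positivity)]
    have : (1 / G ^ 2) ^ 2 * (E / 8) = E / (8 * G ^ 4) := by field_simp
    linarith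
  calc G ^ 2 * _ ≤ G ^ 2 * (1 / G ^ 2) := by gcongr
    _ = 1 := by field_simp

lemma spike_eq_one_of_ge {G E x : ℝ} (hE : 0 < E)
    (h : spikeBase G E + E / 8 ≤ x) : spike G E x = 1 := by
  refine bump_eq_one_of_ge ?_
  rw [Real.one_le_sqrt, le_div_iff₀ (by positivity)]
  linarith

lemma one_le_spike (G E x : ℝ) : 1 ≤ spike G E x := one_le_bump _ _

lemma spike_le {G : ℝ} (hG : 1 ≤ G) (E x : ℝ) : spike G E x ≤ G := bump_le hG (Real.sqrt_nonneg _)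

lemma integrableOn_spike {G : ℝ} (hG : 1 ≤ G) (E : ℝ) {s : Set ℝ} (hs : volume s ≠ ∞) :
    IntegrableOn (spike G E) s := by
  refine IntegrableOn.of_bound hs.lt_top (measurable_spike G E).aestronglyMeasurable G ?_
  refine Filter.Eventually.of_forall fun x => ?_
  rw [Real.norm_of_nonneg (by linarith [one_le_spike G E x])]
  exact spike_le hG E x

lemma spike_le_mul {G E x v : ℝ} (hE : 0 < E) (hx : spikeBase G E < x) (hxv : x ≤ v) :
    spike G E x ≤ spike G E v * √(v - spikeBase G E) * (√(x - spikeBase G E))⁻¹ := by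
  have h1 : 0 < √((x - spikeBase G E) / (E / 8)) := by
    apply Real.sqrt_pos.2; apply div_pos <;> linarith
  have h := mul_bump_mono (G := G) (b := √((v - spikeBase G E) / (E / 8))) h1 (by gcongr)
  have h2 : 0 < √(x - spikeBase G E) := Real.sqrt_pos.2 (by linarith)
  have h3 : 0 < √(E / 8) := Real.sqrt_pos.2 (by linarith)
  rw [← div_eq_mul_inv, le_div_iff₀ h2]
  change _ * spike G E x ≤ _ * spike G E v at h
  rw [Real.sqrt_div (show 0 ≤ x - spikeBase G E by linarith),
    Real.sqrt_div (show 0 ≤ v - spikeBase G E by linarith), div_mul_eq_mul_div,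
    div_mul_eq_mul_div, div_le_div_iff_of_pos_right h3] at h
  linarith

lemma le_mul_spike {G E x v n : ℝ} (hE : 0 < E) (hx : spikeBase G E < x) (hxv : x ≤ v)
    (hn : 1 ≤ n) (h : v - spikeBase G E ≤ n * (x - spikeBase G E)) :
    spike G E v ≤ n * spike G E x := by
  have h1 : 0 < √((x - spikeBase G E) / (E / 8)) := by
    apply Real.sqrt_pos.2; apply div_pos <;> linarith
  have h4 := mul_bump_swap (G := G) (b := √((v - spikeBase G E) / (E / 8))) h1 (by gcongr)
  change _ * spike G E v ≤ _ * spike G E x at h4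
  have h5 : √((v - spikeBase G E) / (E / 8)) ≤ n * √((x - spikeBase G E) / (E / 8)) := by
    rw [Real.sqrt_le_left (by positivity), mul_pow, Real.sq_sqrt (by apply div_nonneg <;> linarith),
      ← mul_div_assoc]
    gcongr
    nlinarith
  have h6 := one_le_spike G E x
  refine le_of_mul_le_mul_left (h4.trans ?_) h1
  nlinarith

lemma setIntegral_inv_sqrt_le {q u v : ℝ} (hq : q < u) (huv : u ≤ v) :
    IntegrableOn (fun x => (√(x - q))⁻¹) (Ico u v) ∧
    √(v - q) * ∫ x in Ico u v, (√(x - q))⁻¹ ≤ 2 * (v - u) := by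
  have hcont : ContinuousOn (fun x => (√(x - q))⁻¹) (uIcc u v) := by
    rw [uIcc_of_le huv]
    refine ContinuousOn.inv₀ (by fun_prop) fun x hx => ?_
    exact (Real.sqrt_pos.2 (by linarith [hx.1])).ne'
  have hI := hcont.intervalIntegrable (μ := volume)
  have hF : ∀ x ∈ uIcc u v, HasDerivAt (fun x => 2 * √(x - q)) ((√(x - q))⁻¹) x := by
    intro x hx
    rw [uIcc_of_le huv] at hx
    have hx0 : 0 < x - q := by linarith [hx.1]
    have := (((hasDerivAt_id' x).sub_const q).sqrt hx0.ne').const_mul 2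
    exact this.congr_deriv (by field_simp)
  have := intervalIntegral.integral_eq_sub_of_hasDerivAt hF hI
  rw [intervalIntegral.integral_of_le huv, ← integral_Ico_eq_integral_Ioc] at this
  refine ⟨(intervalIntegrable_iff_integrableOn_Ico_of_le huv).1 hI, ?_⟩
  rw [this]
  have h1 := Real.sq_sqrt (show 0 ≤ v - q by linarith)
  have h2 := Real.sq_sqrt (show 0 ≤ u - q by linarith)
  have h3 : √(u - q) ≤ √(v - q) := by gcongr
  nlinarith [Real.sqrt_nonneg (u - q)]

lemma setIntegral_spike_le {G E u v : ℝ} (hG : 1 ≤ G) (hE : 0 < E) (hq : spikeBase G E < u)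
    (huv : u ≤ v) : ∫ x in Ico u v, spike G E x ≤ 2 * spike G E v * (v - u) := by
  obtain ⟨h1, h2⟩ := setIntegral_inv_sqrt_le hq huv
  calc _ ≤ ∫ x in Ico u v, spike G E v * √(v - spikeBase G E) * (√(x - spikeBase G E))⁻¹ := by
        refine setIntegral_mono_on (integrableOn_spike hG E (by simp)) (h1.const_mul _)
          measurableSet_Ico fun x hx => spike_le_mul hE (by linarith [hx.1]) hx.2.le
    _ = spike G E v * (√(v - spikeBase G E) * ∫ x in Ico u v, (√(x - spikeBase G E))⁻¹) := by
        rw [integral_const_mul, mul_assoc]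
    _ ≤ spike G E v * (2 * (v - u)) := by
        have := one_le_spike G E v
        gcongr
    _ = _ := by ring

lemma setLIntegral_spike_le {G E : ℝ} (hG : 1 ≤ G) (hE : 0 < E) :
    ∫⁻ x in Ioc (E / 4) (4 * E), ENNReal.ofReal (spike G E x) ≤
      2 * volume (Ioc (E / 4) (4 * E)) := by
  set c := spikeBase G E + E / (8 * G ^ 4)
  have hG4 := one_le_pow₀ hG (n := 4)
  have hc0 : 0 < E / (8 * G ^ 4) := by positivity
  have hc1 : E / (8 * G ^ 4) ≤ E / 8 := by gcongr; linarith
  have hb := spikeBase_ge hG hE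
  have hb' := spikeBase_le (G := G) hE
  have hcE : E / 4 ≤ c := by simp only [c]; linarith
  have hcE' : c ≤ 4 * E := by simp only [c]; linarith
  have hv : spike G E (4 * E) = 1 := spike_eq_one_of_ge hE (by linarith)
  rw [← Ioc_union_Ioc_eq_Ioc hcE hcE',
    lintegral_union measurableSet_Ioc (Ioc_disjoint_Ioc_of_le le_rfl),
    measure_union (Ioc_disjoint_Ioc_of_le le_rfl) measurableSet_Ioc, mul_add]
  gcongr
  · calc _ = ∫⁻ x in Ioc (E / 4) c, 1 := by
          refine setLIntegral_congr_fun measurableSet_Ioc fun x hx => ?_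
          simp [spike_eq_one_of_le hG hE hx.2]
      _ = 1 * volume (Ioc (E / 4) c) := by simp
      _ ≤ _ := by gcongr; norm_num
  · rw [← ofReal_integral_eq_lintegral_ofReal (integrableOn_spike hG E (by simp))
      (Filter.Eventually.of_forall fun x => zero_le_one.trans (one_le_spike G E x)),
      integral_Ioc_eq_integral_Ioo, ← integral_Ico_eq_integral_Ioo]
    have := setIntegral_spike_le hG hE (show spikeBase G E < c by simp only [c]; linarith) hcE'
    rw [hv] at this
    rw [Real.volume_Ioc]
    calc _ ≤ ENNReal.ofReal (2 * (4 * E - c)) := ENNReal.ofReal_le_ofReal (by linarith)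
      _ = _ := by rw [ENNReal.ofReal_mul (by norm_num)]; simp

/-- The index `k` for which `x` lies in the cell `(16⁻ᵏ / 4, 4 * 16⁻ᵏ]`. -/
noncomputable def cellIndex (x : ℝ) : ℕ := ⌊1 / 2 - Real.logb 16 x⌋.toNat

lemma measurable_cellIndex : Measurable cellIndex := by
  unfold cellIndex
  have h : Measurable fun x : ℝ => ⌊1 / 2 - Real.logb 16 x⌋ := by
    simp only [Real.logb]
    exact Int.measurable_floor.comp (by fun_prop)
  exact (measurable_from_top (f := Int.toNat)).comp h

lemma sixteen_rpow_half : (16 : ℝ) ^ (1 / 2 : ℝ) = 4 := by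
  rw [← Real.sqrt_eq_rpow, show (16 : ℝ) = 4 ^ 2 by norm_num, Real.sqrt_sq (by norm_num)]

lemma logb_cell_right (k : ℕ) : Real.logb 16 (4 * (1 / 16) ^ k) = 1 / 2 - k := by
  rw [Real.logb_eq_iff_rpow_eq (by norm_num) (by norm_num) (by positivity),
    Real.rpow_sub (by norm_num), sixteen_rpow_half, Real.rpow_natCast]
  simp [div_eq_mul_inv]

lemma logb_cell_left (k : ℕ) : Real.logb 16 ((1 / 16) ^ k / 4) = -1 / 2 - k := by
  have h : ((1 / 16 : ℝ) ^ k / 4) = 4 * (1 / 16) ^ (k + 1) := by ring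
  rw [h, logb_cell_right]
  push_cast
  ring

lemma cellIndex_eq {k : ℕ} {x : ℝ} (hx : x ∈ Ioc ((1 / 16 : ℝ) ^ k / 4) (4 * (1 / 16) ^ k)) :
    cellIndex x = k := by
  have hE : (0 : ℝ) < (1 / 16) ^ k := by positivity
  have hx0 : 0 < x := by linarith [hx.1]
  have h1 := Real.logb_lt_logb (b := 16) (by norm_num) (by positivity) hx.1
  have h2 := Real.logb_le_logb_of_le (b := 16) (by norm_num) hx0 hx.2
  rw [logb_cell_left] at h1
  rw [logb_cell_right] at h2
  have : ⌊1 / 2 - Real.logb 16 x⌋ = (k : ℤ) := by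
    rw [Int.floor_eq_iff]
    push_cast
    constructor <;> linarith
  rw [cellIndex, this, Int.toNat_natCast]

lemma mem_cell {x : ℝ} (hx0 : 0 < x) (hx1 : x ≤ 1) :
    x ∈ Ioc ((1 / 16 : ℝ) ^ cellIndex x / 4) (4 * (1 / 16) ^ cellIndex x) := by
  have hlog : Real.logb 16 x ≤ 0 := Real.logb_nonpos (by norm_num) hx0.le hx1
  have h0 : 0 ≤ ⌊1 / 2 - Real.logb 16 x⌋ := Int.floor_nonneg.2 (by linarith)
  have hc : ((cellIndex x : ℕ) : ℝ) = (⌊1 / 2 - Real.logb 16 x⌋ : ℝ) := by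
    have : ((cellIndex x : ℕ) : ℤ) = ⌊1 / 2 - Real.logb 16 x⌋ := Int.toNat_of_nonneg h0
    exact_mod_cast this
  have h1 := Int.floor_le (1 / 2 - Real.logb 16 x)
  have h2 := Int.lt_floor_add_one (1 / 2 - Real.logb 16 x)
  rw [← hc] at h1 h2
  constructor
  · rw [← Real.logb_lt_logb_iff (b := 16) (by norm_num) (by positivity) hx0, logb_cell_left]
    linarith
  · rw [← Real.logb_le_logb (b := 16) (by norm_num) hx0 (by positivity), logb_cell_right]
    linarith

/-- The weight carrying a spike of height about `G k` to the right of every point `16⁻ᵏ`. -/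
noncomputable def spikeWeight (G : ℕ → ℕ) (x : ℝ) : ℝ :=
  spike (G (cellIndex x)) ((1 / 16) ^ cellIndex x) x

lemma measurable_spikeWeight (G : ℕ → ℕ) : Measurable (spikeWeight G) := by
  let f : ℝ × ℕ → ℝ := fun p => spike (G p.2) ((1 / 16) ^ p.2) p.1
  have h : Measurable f := by
    refine measurable_from_prod_countable_left fun k => ?_
    simp only [f]
    exact measurable_spike _ _
  have h' : spikeWeight G = f ∘ fun x => (x, cellIndex x) := by
    funext x
    simp only [spikeWeight, f, Function.comp_apply]
  rw [h']
  exact h.comp (measurable_id.prodMk measurable_cellIndex)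

lemma one_le_spikeWeight (G : ℕ → ℕ) (x : ℝ) : 1 ≤ spikeWeight G x := one_le_spike _ _ _

lemma spikeWeight_eq (G : ℕ → ℕ) {k : ℕ} {x : ℝ}
    (hx : x ∈ Ioc ((1 / 16 : ℝ) ^ k / 4) (4 * (1 / 16) ^ k)) :
    spikeWeight G x = spike (G k) ((1 / 16) ^ k) x := by
  rw [spikeWeight, cellIndex_eq hx]

lemma setLIntegral_spikeWeight_le {G : ℕ → ℕ} (hG : ∀ k, 1 ≤ G k) {y : ℝ} (hy : y ≤ 1) :
    ∫⁻ x in Ico 0 y, ENNReal.ofReal (spikeWeight G x) ≤ ENNReal.ofReal (32 * y) := by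
  let c : ℕ → Set ℝ := fun k => Ioc ((1 / 16 : ℝ) ^ k / 4) (4 * (1 / 16) ^ k)
  let S : Set ℕ := {k | (1 / 16 : ℝ) ^ k / 4 < y}
  have hdisj : S.PairwiseDisjoint c := by
    intro i _ j _ hij
    refine Set.disjoint_left.2 fun x hi hj => hij ?_
    rw [← cellIndex_eq hi, cellIndex_eq hj]
  have hsub : Ioo 0 y ⊆ ⋃ k ∈ S, c k := by
    intro x hx
    have h := mem_cell hx.1 (hx.2.le.trans hy)
    exact mem_biUnion (h.1.trans hx.2) h
  have hsub' : ⋃ k ∈ S, c k ⊆ Ioc 0 (16 * y) := by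
    refine iUnion₂_subset fun k hk x hx => ⟨lt_trans (by positivity) hx.1, hx.2.trans ?_⟩
    have : (1 / 16 : ℝ) ^ k / 4 < y := hk
    linarith
  have hm : ∀ k ∈ S, MeasurableSet (c k) := fun _ _ => measurableSet_Ioc
  calc _ = ∫⁻ x in Ioo 0 y, ENNReal.ofReal (spikeWeight G x) := by
        rw [setLIntegral_congr Ioo_ae_eq_Ico]
    _ ≤ ∫⁻ x in ⋃ k ∈ S, c k, ENNReal.ofReal (spikeWeight G x) := lintegral_mono_set hsub
    _ = ∑' k : S, ∫⁻ x in c k, ENNReal.ofReal (spikeWeight G x) :=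
        lintegral_biUnion S.to_countable hm hdisj _
    _ ≤ ∑' k : S, 2 * volume (c k) := by
        refine ENNReal.tsum_le_tsum fun k => ?_
        refine le_trans (le_of_eq ?_) (setLIntegral_spike_le (G := G k) (E := (1 / 16) ^ (k : ℕ))
          (by exact_mod_cast hG k) (by positivity))
        refine setLIntegral_congr_fun measurableSet_Ioc fun x hx => ?_
        simp only [spikeWeight_eq G hx]
    _ = 2 * volume (⋃ k ∈ S, c k) := by
        rw [ENNReal.tsum_mul_left, measure_biUnion S.to_countable hdisj hm]
    _ ≤ 2 * volume (Ioc 0 (16 * y)) := by gcongr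
    _ = _ := by
        rw [Real.volume_Ioc, sub_zero, show 32 * y = 2 * (16 * y) by ring,
          ENNReal.ofReal_mul zero_le_two]
        simp

lemma integrableOn_spikeWeight {G : ℕ → ℕ} (hG : ∀ k, 1 ≤ G k) :
    IntegrableOn (spikeWeight G) (Ico 0 1) := by
  refine ⟨(measurable_spikeWeight G).aestronglyMeasurable, ?_⟩
  rw [hasFiniteIntegral_iff_ofReal
    (Filter.Eventually.of_forall fun x => zero_le_one.trans (one_le_spikeWeight G x))]
  exact (setLIntegral_spikeWeight_le hG le_rfl).trans_lt ENNReal.ofReal_lt_top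

lemma setIntegral_spikeWeight_le {G : ℕ → ℕ} (hG : ∀ k, 1 ≤ G k) {y : ℝ} (hy0 : 0 ≤ y)
    (hy : y ≤ 1) : ∫ x in Ico 0 y, spikeWeight G x ≤ 32 * y := by
  rw [integral_eq_lintegral_of_nonneg_ae
    (Filter.Eventually.of_forall fun x => zero_le_one.trans (one_le_spikeWeight G x))
    (measurable_spikeWeight G).aestronglyMeasurable]
  exact ENNReal.toReal_le_of_le_ofReal (by positivity) (setLIntegral_spikeWeight_le hG hy)

/-- On every interval `J = [u, v)` at hand the weight `W` has average at most `K * A`,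
and is at least `A / K` on the right half of each subinterval of length at least `(v - u) / n`. -/
def LevelOn (W : ℝ → ℝ) (n K A u v : ℝ) : Prop :=
  0 < A ∧ ∫ x in Ico u v, W x ≤ K * A * (v - u) ∧
    ∀ u' v', u ≤ u' → v' ≤ v → v - u ≤ n * (v' - u') →
      ∀ x ∈ Ico ((u' + v') / 2) v', A / K ≤ W x

lemma levelOn_of_le {W : ℝ → ℝ} {n K u v : ℝ} (huv : u ≤ v) (hK : 1 ≤ K)
    (h1 : ∀ x ∈ Ico u v, 1 ≤ W x) (hint : ∫ x in Ico u v, W x ≤ K * (v - u)) (hn : 1 ≤ n) :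
    LevelOn W n K 1 u v := by
  refine ⟨one_pos, by simpa using hint, fun u' v' hu hv h x hx => ?_⟩
  have : 0 ≤ v' - u' := by
    by_contra hc
    nlinarith
  refine le_trans ?_ (h1 x ⟨by linarith [hx.1], by linarith [hx.2]⟩)
  rw [div_le_one (by linarith)]
  exact hK

lemma levelOn_of_bounded {W : ℝ → ℝ} {n K u v : ℝ} (huv : u ≤ v) (hK : 1 ≤ K)
    (h1 : ∀ x ∈ Ico u v, 1 ≤ W x) (h2 : ∀ x ∈ Ico u v, W x ≤ K) (hn : 1 ≤ n) :
    LevelOn W n K 1 u v := by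
  refine levelOn_of_le huv hK h1 ?_ hn
  have := norm_setIntegral_le_of_norm_le_const (μ := volume) (s := Ico u v) (f := W) (C := K)
    (by simp) (fun x hx => by
      rw [Real.norm_of_nonneg (by linarith [h1 x hx])]; exact h2 x hx)
  refine (le_abs_self _).trans (this.trans ?_)
  simp [huv]

lemma levelOn_spike {G E n u v : ℝ} (hG : 1 ≤ G) (hE : 0 < E) (hq : spikeBase G E < u)
    (huv : u ≤ v) (hn : 1 ≤ n) : LevelOn (spike G E) n (2 * n) (spike G E v) u v := by
  have h1 := one_le_spike G E v
  refine ⟨by linarith, ?_, fun u' v' hu hv h x hx => ?_⟩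
  · refine (setIntegral_spike_le hG hE hq huv).trans ?_
    have : 0 ≤ spike G E v * (v - u) := mul_nonneg (by linarith) (by linarith)
    nlinarith
  · have hx' := hx.1
    have hx'' := hx.2
    rw [div_le_iff₀ (by linarith), mul_comm]
    refine le_mul_spike hE (by linarith) (by linarith) (by linarith) ?_
    nlinarith

lemma LevelOn.congr {W W' : ℝ → ℝ} {n K A u v : ℝ} (h : LevelOn W n K A u v) (hn : 1 ≤ n)
    (huv : u ≤ v) (hW : ∀ x ∈ Ico u v, W' x = W x) : LevelOn W' n K A u v := by
  refine ⟨h.1, ?_, fun u' v' hu hv h' x hx => ?_⟩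
  · rw [setIntegral_congr_fun measurableSet_Ico hW]
    exact h.2.1
  · have : 0 ≤ v' - u' := by
      by_contra hc
      nlinarith
    rw [hW x ⟨by linarith [hx.1], by linarith [hx.2]⟩]
    exact h.2.2 u' v' hu hv h' x hx

lemma LevelOn.mono {W : ℝ → ℝ} {n K K' A u v : ℝ} (h : LevelOn W n K A u v) (hK : 0 < K)
    (huv : u ≤ v) (hKK' : K ≤ K') : LevelOn W n K' A u v := by
  have hA := h.1
  refine ⟨hA, h.2.1.trans ?_, fun u' v' hu hv h' x hx => le_trans ?_ (h.2.2 u' v' hu hv h' x hx)⟩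
  · have : 0 ≤ v - u := by linarith
    gcongr
  · gcongr

lemma le_zpow_or_zpow_le {n : ℕ} (hn : 2 ≤ n) {c : ℤ} (hc : 2 ≤ c) (i m : ℤ) :
    (c : ℝ) / (n : ℝ) ^ i ≤ (n : ℝ) ^ (-m) ∨ (n : ℝ) ^ (-m) ≤ ((c : ℝ) - 1) / (n : ℝ) ^ i := by
  have hn0 : (0 : ℝ) < n := by positivity
  have hi : (0 : ℝ) < (n : ℝ) ^ i := by positivity
  rw [div_le_iff₀ hi, le_div_iff₀ hi, ← zpow_add₀ hn0.ne']
  rcases le_or_gt m i with h | h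
  · obtain ⟨d, hd⟩ := Int.eq_ofNat_of_zero_le (show 0 ≤ -m + i by omega)
    rw [hd]
    have : ((n : ℝ) ^ (d : ℤ)) = ((n ^ d : ℤ) : ℝ) := by push_cast; simp
    rw [this]
    rcases le_or_gt c (n ^ d) with h' | h'
    · exact Or.inl (by exact_mod_cast h')
    · exact Or.inr (by have := Int.le_sub_one_of_lt h'; exact_mod_cast this)
  · right
    have h1 : (n : ℝ) ^ (-m + i) ≤ 1 :=
      zpow_le_one_of_nonpos₀ (by exact_mod_cast (by omega)) (by omega)
    have h2 : (2 : ℝ) ≤ c := by exact_mod_cast hc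
    linarith

lemma nadicI_subset_unit {n : ℕ} (hn : 2 ≤ n) {i c : ℤ} (h : nadicI n i c ⊆ Ico 0 1) :
    1 ≤ c ∧ (c : ℝ) / (n : ℝ) ^ i ≤ 1 := by
  have hi : (0 : ℝ) < (n : ℝ) ^ i := by positivity
  have hlt : ((c : ℝ) - 1) / (n : ℝ) ^ i < c / (n : ℝ) ^ i := by gcongr; linarith
  obtain ⟨h1, h2⟩ := (Ico_subset_Ico_iff hlt).1 h
  refine ⟨?_, h2⟩
  have : (0 : ℝ) ≤ c - 1 := by
    by_contra hc
    exact absurd h1 (not_le.2 (div_neg_of_neg_of_pos (not_le.1 hc) hi))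
  have : (1 : ℝ) ≤ c := by linarith
  exact_mod_cast this

lemma exists_levelOn {G : ℕ → ℕ} (hG : ∀ k, 1 ≤ G k)
    (hG' : ∀ k n, 2 ≤ n → n < G k →
      ∃ m : ℤ, |(n : ℝ) ^ (-m) * 16 ^ k - 1| < 1 / (16 * (G k : ℝ) ^ 4))
    {n : ℕ} (hn : 2 ≤ n) {i c : ℤ} (h : nadicI n i c ⊆ Ico 0 1) :
    ∃ A, LevelOn (spikeWeight G) n (32 * n) A (((c : ℝ) - 1) / (n : ℝ) ^ i)
      ((c : ℝ) / (n : ℝ) ^ i) := by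
  obtain ⟨hc, hv1⟩ := nadicI_subset_unit hn h
  have hn2 : (2 : ℝ) ≤ n := by exact_mod_cast hn
  have hi : (0 : ℝ) < (n : ℝ) ^ i := by positivity
  have hdich := fun hc m => le_zpow_or_zpow_le hn (c := c) hc i m
  have huv2 : 2 ≤ c → (c : ℝ) / (n : ℝ) ^ i ≤ 2 * (((c : ℝ) - 1) / (n : ℝ) ^ i) := by
    intro hc
    have : (2 : ℝ) ≤ c := by exact_mod_cast hc
    rw [← mul_div_assoc]
    gcongr
    linarith
  have huv : ((c : ℝ) - 1) / (n : ℝ) ^ i < c / (n : ℝ) ^ i := by gcongr; linarith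
  have hu0 : c = 1 → ((c : ℝ) - 1) / (n : ℝ) ^ i = 0 := by rintro rfl; simp
  set u := ((c : ℝ) - 1) / (n : ℝ) ^ i
  set v := (c : ℝ) / (n : ℝ) ^ i
  have hW1 : ∀ x ∈ Ico u v, 1 ≤ spikeWeight G x := fun x _ => one_le_spikeWeight G x
  have hK : (1 : ℝ) ≤ 32 * n := by linarith
  have hn1 : (1 : ℝ) ≤ n := by linarith
  rcases hc.eq_or_lt with hc1 | hc2
  · rw [hu0 hc1.symm] at *
    refine ⟨1, levelOn_of_le huv.le hK hW1 ?_ hn1⟩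
    refine (setIntegral_spikeWeight_le hG huv.le hv1).trans ?_
    nlinarith
  have hdich' := hdich hc2
  have huv' := huv2 hc2
  by_cases hall : ∀ x ∈ Ico u v, spikeWeight G x = 1
  · exact ⟨1, levelOn_of_bounded huv.le hK hW1 (fun x hx => by rw [hall x hx]; exact hK) hn1⟩
  push Not at hall
  obtain ⟨x, hx, hx1⟩ := hall
  have hu0 : 0 < u := by linarith
  set k := cellIndex x
  have hE : (0 : ℝ) < (1 / 16) ^ k := by positivity
  have hxk : spikeWeight G x = spike (G k) ((1 / 16) ^ k) x := rfl
  have hE16 : (16 : ℝ) ^ k * (1 / 16) ^ k = 1 := by rw [← mul_pow]; norm_num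
  have hGk : (1 : ℝ) ≤ G k := by exact_mod_cast hG k
  set E : ℝ := (1 / 16) ^ k
  have hq1 := spikeBase_ge hGk hE
  have hq2 := spikeBase_le (G := G k) hE
  have hxl : spikeBase (G k) E < x := by
    by_contra hcon
    exact hx1 (hxk.trans (spike_eq_one_of_le hGk hE
      ((not_lt.1 hcon).trans (le_add_of_nonneg_right (by positivity)))))
  have hxr : x < spikeBase (G k) E + E / 8 := by
    by_contra hcon
    exact hx1 (hxk.trans (spike_eq_one_of_ge hE (not_lt.1 hcon)))
  have hcell : ∀ y ∈ Ico u v, spikeWeight G y = spike (G k) E y := fun y hy =>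
    spikeWeight_eq G ⟨by linarith [hy.1, hx.2], by linarith [hy.2, hx.1]⟩
  rcases le_or_gt (G k) n with hgn | hgn
  · refine ⟨1, levelOn_of_bounded huv.le hK hW1 (fun y hy => ?_) hn1⟩
    rw [hcell y hy]
    refine (spike_le hGk E y).trans ?_
    have : (G k : ℝ) ≤ n := by exact_mod_cast hgn
    linarith
  obtain ⟨m, hm⟩ := hG' k n hn hgn
  have hp : |(n : ℝ) ^ (-m) - E| < E / (16 * (G k : ℝ) ^ 4) := by
    have : (n : ℝ) ^ (-m) - E = ((n : ℝ) ^ (-m) * 16 ^ k - 1) * E := by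
      linear_combination (-(n : ℝ) ^ (-m)) * hE16
    rw [this, abs_mul, abs_of_pos hE]
    calc _ < 1 / (16 * (G k : ℝ) ^ 4) * E := by gcongr
      _ = _ := by ring
  rw [abs_lt] at hp
  have hpl : spikeBase (G k) E < (n : ℝ) ^ (-m) := by unfold spikeBase; linarith
  have hpr : (n : ℝ) ^ (-m) ≤ spikeBase (G k) E + E / (8 * (G k : ℝ) ^ 4) := by
    have : E / (8 * (G k : ℝ) ^ 4) = 2 * (E / (16 * (G k : ℝ) ^ 4)) := by field_simp; norm_num
    unfold spikeBase; linarith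
  rcases hdich' m with hle | hle
  · refine absurd (hxk.trans (spike_eq_one_of_le hGk hE ?_)) hx1
    linarith [hx.2]
  · refine ⟨spike (G k) E v, LevelOn.congr ?_ hn1 huv.le hcell⟩
    exact (levelOn_spike hGk hE (hpl.trans_le hle) huv.le hn1).mono (by linarith) huv.le
      (by linarith)

lemma integrableOn_rpow_of_one_le {W : ℝ → ℝ} (hW : Measurable W) (h1 : ∀ x, 1 ≤ W x) {s : ℝ}
    (hs : s ≤ 1) {J : Set ℝ} (hJ : IntegrableOn W J) :
    IntegrableOn (fun x => W x ^ s) J := by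
  refine Integrable.mono hJ (hW.pow_const s).aestronglyMeasurable
    (Filter.Eventually.of_forall fun x => ?_)
  have h0 : 0 ≤ W x := zero_le_one.trans (h1 x)
  rw [Real.norm_of_nonneg h0, Real.norm_of_nonneg (Real.rpow_nonneg h0 s)]
  exact (Real.rpow_le_rpow_of_exponent_le (h1 x) hs).trans_eq (Real.rpow_one _)

lemma LevelOn.setIntegral_rpow_le {W : ℝ → ℝ} {n K A u v s : ℝ} (h : LevelOn W n K A u v)
    (huv : u ≤ v) (hW : Measurable W) (h1 : ∀ x, 1 ≤ W x) (hs0 : 0 ≤ s) (hs : s ≤ 1)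
    (hJ : IntegrableOn W (Ico u v)) :
    ∫ x in Ico u v, W x ^ s ≤ (1 + K) * A ^ s * (v - u) := by
  obtain ⟨hA, hI, -⟩ := h
  have hAs : 0 < A ^ s := Real.rpow_pos_of_pos hA s
  calc _ ≤ ∫ x in Ico u v, A ^ s * (1 + W x / A) := by
        refine setIntegral_mono (integrableOn_rpow_of_one_le hW h1 hs hJ)
          (((integrableOn_const (by simp)).add (hJ.div_const A)).const_mul _) fun x => ?_
        have h0 : 0 ≤ W x / A := div_nonneg (zero_le_one.trans (h1 x)) hA.le
        have hx : W x ^ s = A ^ s * (W x / A) ^ s := by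
          rw [← Real.mul_rpow hA.le h0, mul_div_cancel₀ _ hA.ne']
        simp only [hx]
        gcongr
        calc (W x / A) ^ s ≤ (1 + W x / A) ^ s := by gcongr; linarith
          _ ≤ (1 + W x / A) ^ (1 : ℝ) := Real.rpow_le_rpow_of_exponent_le (by linarith) hs
          _ = _ := Real.rpow_one _
    _ = A ^ s * ((v - u) + (∫ x in Ico u v, W x) / A) := by
        rw [integral_const_mul, integral_add (integrable_const _) (hJ.div_const A),
          integral_div]
        simp [huv]
    _ ≤ A ^ s * ((v - u) + K * (v - u)) := by
        have : (∫ x in Ico u v, W x) / A ≤ K * (v - u) := by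
          rw [div_le_iff₀ hA]; linarith
        gcongr
    _ = _ := by ring

lemma LevelOn.le_setIntegral_rpow {W : ℝ → ℝ} {n K A u v s u' v' : ℝ} (h : LevelOn W n K A u v)
    (huv' : u' ≤ v') (hu : u ≤ u') (hv : v' ≤ v) (hn : v - u ≤ n * (v' - u')) (hK : 0 < K)
    (hW : Measurable W) (h1 : ∀ x, 1 ≤ W x) (hs0 : 0 ≤ s) (hs : s ≤ 1)
    (hJ : IntegrableOn W (Ico u v)) :
    (A / K) ^ s * ((v' - u') / 2) ≤ ∫ x in Ico u' v', W x ^ s := by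
  have hI := integrableOn_rpow_of_one_le hW h1 hs (hJ.mono_set (Ico_subset_Ico hu hv))
  have hsub : Ico ((u' + v') / 2) v' ⊆ Ico u' v' := Ico_subset_Ico_left (by linarith)
  have hA := h.1
  calc _ = ∫ x in Ico ((u' + v') / 2) v', (A / K) ^ s := by
        rw [setIntegral_const, Real.volume_real_Ico_of_le (by linarith), smul_eq_mul]
        ring
    _ ≤ ∫ x in Ico ((u' + v') / 2) v', W x ^ s := by
        refine setIntegral_mono_on (integrableOn_const (by simp)) (hI.mono_set hsub)
          measurableSet_Ico fun x hx => ?_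
        have := h.2.2 u' v' hu hv hn x hx
        gcongr
    _ ≤ _ := setIntegral_mono_set hI
        (Filter.Eventually.of_forall fun x => Real.rpow_nonneg (zero_le_one.trans (h1 x)) s)
        hsub.eventuallyLE

lemma LevelOn.reverseHolder {W : ℝ → ℝ} {n K A u v s : ℝ} (h : LevelOn W n K A u v)
    (huv : u < v) (hn : 1 ≤ n) (hK : 0 < K)
    (hW : Measurable W) (h1 : ∀ x, 1 ≤ W x) (hs0 : 0 ≤ s) (hs : s ≤ 1)
    (hJ : IntegrableOn W (Ico u v)) :
    (⨍ x in Ico u v, W x) ^ s ≤ 2 * (K * K) ^ s * ⨍ x in Ico u v, W x ^ s := by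
  have hlow := h.le_setIntegral_rpow huv.le le_rfl le_rfl (by nlinarith) hK hW h1 hs0 hs hJ
  obtain ⟨hA, hI, -⟩ := h
  have hl : 0 < v - u := by linarith
  simp only [setAverage_eq, Real.volume_real_Ico_of_le huv.le, smul_eq_mul]
  have h0 : 0 ≤ ∫ x in Ico u v, W x := integral_nonneg fun x => zero_le_one.trans (h1 x)
  calc _ ≤ (K * A) ^ s := by
        refine Real.rpow_le_rpow (by positivity) ?_ hs0
        rw [inv_mul_le_iff₀ hl]; linarith
    _ = 2 * (K * K) ^ s * ((v - u)⁻¹ * ((A / K) ^ s * ((v - u) / 2))) := by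
        have : (K * A) ^ s = (K * K) ^ s * (A / K) ^ s := by
          rw [← Real.mul_rpow (by positivity) (by positivity)]
          congr 1
          field_simp
        rw [this]
        field_simp
    _ ≤ _ := by gcongr

lemma nadic_siblings_parent {n : ℕ} (hn : 2 ≤ n) {m k₁ k₂ k : ℤ}
    (h1 : nadicI n (m + 1) k₁ ⊆ nadicI n m k) (h1' : nadicI n (m + 1) k₁ ⊆ Ico 0 1)
    (h2' : nadicI n (m + 1) k₂ ⊆ Ico 0 1) : k₁ = k₂ ∨ nadicI n m k ⊆ Ico 0 1 := by
  have hn0 : (0 : ℝ) < n := by positivity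
  have hn1 : (1 : ℝ) < n := by exact_mod_cast hn
  obtain ⟨hk1, hv1⟩ := nadicI_subset_unit hn h1'
  obtain ⟨hk2, hv2⟩ := nadicI_subset_unit hn h2'
  rcases lt_or_ge m 0 with hm | hm
  · left
    have hp : (n : ℝ) ^ (m + 1) ≤ 1 := zpow_le_one_of_nonpos₀ hn1.le (by omega)
    rw [div_le_one (by positivity)] at hv1 hv2
    have e1 : (k₁ : ℝ) ≤ 1 := hv1.trans hp
    have e2 : (k₂ : ℝ) ≤ 1 := hv2.trans hp
    have e1' : k₁ ≤ 1 := by exact_mod_cast e1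
    have e2' : k₂ ≤ 1 := by exact_mod_cast e2
    omega
  · right
    obtain ⟨d, rfl⟩ := Int.eq_ofNat_of_zero_le hm
    have hlt : ((k₁ : ℝ) - 1) / (n : ℝ) ^ ((d : ℤ) + 1) < k₁ / (n : ℝ) ^ ((d : ℤ) + 1) := by
      gcongr; linarith
    have hmem : ((k₁ : ℝ) - 1) / (n : ℝ) ^ ((d : ℤ) + 1) ∈ nadicI n ((d : ℤ) + 1) k₁ :=
      ⟨le_rfl, hlt⟩
    obtain ⟨a1, a2⟩ := h1 hmem
    obtain ⟨b1, b2⟩ := h1' hmem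
    have hd : (0 : ℝ) < (n : ℝ) ^ (d : ℤ) := by positivity
    have c1 := b1.trans_lt a2
    have c2 := a1.trans_lt b2
    rw [lt_div_iff₀ hd, zero_mul] at c1
    rw [div_lt_one hd] at c2
    have c1' : 0 < k := by exact_mod_cast c1
    have c2' : k - 1 < (n : ℤ) ^ d := by
      rw [zpow_natCast] at c2; exact_mod_cast c2
    have c3 : (1 : ℝ) ≤ k := by exact_mod_cast c1'
    have c4 : (k : ℝ) ≤ (n : ℝ) ^ (d : ℤ) := by
      rw [zpow_natCast]; exact_mod_cast (show k ≤ (n : ℤ) ^ d by omega)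
    refine Ico_subset_Ico (div_nonneg (by linarith) hd.le) ?_
    rwa [div_le_one hd]

/-- The averages over an interval ending at the peak of a spike of height `G`
violate the reverse Hölder inequality by a factor growing with `G`. -/
lemma exists_interval_of_spike {G E s : ℝ} (hG : 2 ≤ G) (hE : 0 < E) (hE1 : E ≤ 1 / 16)
    (hs0 : 0 < s) (hs : s < 1) :
    ∃ x y : ℝ, E / 4 < x ∧ x < y ∧ y ≤ 4 * E ∧
      G ^ (1 - s) / 8 ≤ ⨍ t in Ico x y, spike G E t ∧
      ⨍ t in Ico x y, spike G E t ^ s ≤ 2 := by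
  have hG1 : 1 ≤ G := by linarith
  have hq1 := spikeBase_ge hG1 hE
  have hq2 := spikeBase_le (G := G) hE
  have hθ1 : 1 ≤ G ^ s := Real.one_le_rpow hG1 hs0.le
  have hθ2 : G ^ s ≤ G := (Real.rpow_le_rpow_of_exponent_le hG1 hs.le).trans_eq (Real.rpow_one G)
  have hθ3 : G ^ (1 - s) * G ^ s = G := by
    rw [← Real.rpow_add (by linarith)]; simp
  set q := spikeBase G E with hq
  set θ := G ^ s
  set τ := E / 8 / G ^ 2 with hτ
  have hτ0 : 0 < τ := by positivity
  have hτG : τ * G ^ 2 = E / 8 := by rw [hτ]; field_simp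
  have hτθ : τ * θ ≤ E / 8 := by
    rw [← hτG]; gcongr; nlinarith
  have hτ1 : τ ≤ τ * θ := by nlinarith
  have hS : ∀ a b, IntegrableOn (spike G E) (Ico a b) := fun a b =>
    integrableOn_spike hG1 E (by simp)
  have hSs : ∀ a b, IntegrableOn (fun t => spike G E t ^ s) (Ico a b) := fun a b =>
    integrableOn_rpow_of_one_le (measurable_spike G E) (one_le_spike G E) hs.le (hS a b)
  have hlen : q + τ - (q - τ * θ) = τ + τ * θ := by ring
  have hlen0 : 0 < τ + τ * θ := by nlinarith
  refine ⟨q - τ * θ, q + τ, by linarith, by linarith, by linarith, ?_, ?_⟩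
  · rw [setAverage_eq, Real.volume_real_Ico_of_le (by linarith), smul_eq_mul, hlen,
      inv_mul_eq_div, le_div_iff₀ hlen0]
    have hhigh : ∀ t ∈ Ico (q + τ / 4) (q + τ), G / 2 ≤ spike G E t := by
      intro t ht
      have hσ1 : 1 / (2 * G) ≤ √((t - q) / (E / 8)) := by
        apply Real.le_sqrt_of_sq_le
        rw [le_div_iff₀ (by positivity), ← hτG]
        have : (1 / (2 * G)) ^ 2 * (τ * G ^ 2) = τ / 4 := by field_simp; norm_num
        linarith [ht.1]
      have hσ2 : √((t - q) / (E / 8)) ≤ 1 / G := by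
        rw [Real.sqrt_le_left (by positivity), div_le_iff₀ (by positivity), ← hτG]
        have : (1 / G) ^ 2 * (τ * G ^ 2) = τ := by field_simp
        linarith [ht.2]
      have hpos : 0 < √((t - q) / (E / 8)) := lt_of_lt_of_le (by positivity) hσ1
      refine le_max_of_le_right (le_min ?_ ?_)
      · calc G / 2 = G ^ 2 * (1 / (2 * G)) := by field_simp
          _ ≤ _ := by rw [← hq]; gcongr
      · rw [← hq, le_div_iff₀ hpos]
        calc G / 2 * _ ≤ G / 2 * (1 / G) := by gcongr
          _ = 1 / 2 := by field_simp
          _ ≤ 1 := by norm_num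
    have hsub : Ico (q + τ / 4) (q + τ) ⊆ Ico (q - τ * θ) (q + τ) :=
      Ico_subset_Ico_left (by linarith)
    calc G ^ (1 - s) / 8 * (τ + τ * θ) ≤ G ^ (1 - s) / 8 * (2 * (τ * θ)) := by
          have : 0 ≤ G ^ (1 - s) := by positivity
          gcongr; linarith
      _ = τ * G / 4 := by linear_combination (τ / 4) * hθ3
      _ ≤ (q + τ - (q + τ / 4)) * (G / 2) := by nlinarith
      _ = ∫ t in Ico (q + τ / 4) (q + τ), G / 2 := by
          rw [setIntegral_const, Real.volume_real_Ico_of_le (by linarith), smul_eq_mul]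
      _ ≤ ∫ t in Ico (q + τ / 4) (q + τ), spike G E t :=
          setIntegral_mono_on (integrableOn_const (by simp)) (hS _ _) measurableSet_Ico hhigh
      _ ≤ _ := setIntegral_mono_set (hS _ _)
          (Filter.Eventually.of_forall fun t => zero_le_one.trans (one_le_spike G E t))
          hsub.eventuallyLE
  · rw [setAverage_eq, Real.volume_real_Ico_of_le (by linarith), smul_eq_mul, hlen,
      inv_mul_le_iff₀ hlen0, ← Ico_union_Ico_eq_Ico (b := q) (by linarith) (by linarith),
      setIntegral_union (Ico_disjoint_Ico_same) measurableSet_Ico (hSs _ _) (hSs _ _)]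
    have h1 : ∫ t in Ico (q - τ * θ) q, spike G E t ^ s = τ * θ := by
      calc _ = ∫ t in Ico (q - τ * θ) q, (1 : ℝ) := by
            refine setIntegral_congr_fun measurableSet_Ico fun t ht => ?_
            rw [spike_eq_one_of_le hG1 hE
              (ht.2.le.trans (le_add_of_nonneg_right (by positivity))), Real.one_rpow]
        _ = _ := by
            rw [setIntegral_const, Real.volume_real_Ico_of_le (by linarith)]; simp
    have h2 : ∫ t in Ico q (q + τ), spike G E t ^ s ≤ τ * θ := by
      calc _ ≤ ∫ t in Ico q (q + τ), θ := by
            refine setIntegral_mono (hSs _ _) (integrableOn_const (by simp)) fun t => ?_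
            exact Real.rpow_le_rpow (zero_le_one.trans (one_le_spike G E t))
              (spike_le hG1 E t) hs0.le
        _ = _ := by
            rw [setIntegral_const, Real.volume_real_Ico_of_le (by linarith)]; simp
    linarith

lemma withDensity_ofReal_rpow_apply {W : ℝ → ℝ} (hW : Measurable W) (h1 : ∀ x, 1 ≤ W x) {s : ℝ}
    (hs : s ≤ 1) {J : Set ℝ} (hJm : MeasurableSet J) (hJ : IntegrableOn W J) :
    volume.withDensity (fun x => ENNReal.ofReal (W x ^ s)) J =
      ENNReal.ofReal (∫ x in J, W x ^ s) := by
  rw [withDensity_apply _ hJm, ofReal_integral_eq_lintegral_ofReal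
    (integrableOn_rpow_of_one_le hW h1 hs hJ)
    (Filter.Eventually.of_forall fun x => Real.rpow_nonneg (zero_le_one.trans (h1 x)) s)]

lemma LevelOn.setIntegral_rpow_le_mul {W : ℝ → ℝ} {n K A u v s u₁ v₁ u₂ v₂ : ℝ}
    (h : LevelOn W n K A u v) (hK : 0 < K) (hn : 0 ≤ n)
    (huv : u ≤ v) (h₁ : Ico u₁ v₁ ⊆ Ico u v)
    (huv₂ : u₂ ≤ v₂) (hu₂ : u ≤ u₂) (hv₂ : v₂ ≤ v) (hlen : v - u ≤ n * (v₂ - u₂))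
    (hW : Measurable W) (h1 : ∀ x, 1 ≤ W x) (hs0 : 0 ≤ s) (hs : s ≤ 1)
    (hJ : IntegrableOn W (Ico u v)) :
    ∫ x in Ico u₁ v₁, W x ^ s ≤ 2 * n * (1 + K) * K ^ s * ∫ x in Ico u₂ v₂, W x ^ s := by
  have hA := h.1
  have hlow := h.le_setIntegral_rpow huv₂ hu₂ hv₂ hlen hK hW h1 hs0 hs hJ
  calc _ ≤ ∫ x in Ico u v, W x ^ s := setIntegral_mono_set
        (integrableOn_rpow_of_one_le hW h1 hs hJ)
        (Filter.Eventually.of_forall fun x => Real.rpow_nonneg (zero_le_one.trans (h1 x)) s)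
        h₁.eventuallyLE
    _ ≤ (1 + K) * A ^ s * (v - u) := h.setIntegral_rpow_le huv hW h1 hs0 hs hJ
    _ ≤ (1 + K) * A ^ s * (n * (v₂ - u₂)) := by gcongr
    _ = 2 * n * (1 + K) * K ^ s * ((A / K) ^ s * ((v₂ - u₂) / 2)) := by
        rw [Real.div_rpow hA.le hK.le]
        have : K ^ s ≠ 0 := (Real.rpow_pos_of_pos hK s).ne'
        field_simp
    _ ≤ _ := by gcongr

/-- Theorem 1.3, part 1: `⋂_{n ≥ 2} RH_r^n ⊊ RH_r`. There is a weight `w`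
on `[0,1)` which, for every `n ≥ 2`, generates an `n`-adic doubling measure and satisfies
the reverse Hölder-`r` inequality over `n`-adic intervals, yet does not satisfy the
reverse Hölder-`r` inequality over arbitrary intervals. -/
theorem nadic_reverseHolder_intersection_ne (r : ℝ) (hr : 1 < r) :
    ∃ w : ℝ → ℝ, Measurable w ∧ (∀ x ∈ Set.Ico (0:ℝ) 1, 0 < w x) ∧
      IntegrableOn w (Set.Ico 0 1) ∧ IntegrableOn (fun x => w x ^ r) (Set.Ico 0 1) ∧
      (∀ n : ℕ, 2 ≤ n → ∃ C₀ : ℝ, 0 < C₀ ∧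
        ∀ J₁ J₂ : Set ℝ, NAdicSiblings n J₁ J₂ → J₁ ⊆ Set.Ico 0 1 → J₂ ⊆ Set.Ico 0 1 →
          volume.withDensity (fun x => ENNReal.ofReal (w x)) J₁ ≤
            ENNReal.ofReal C₀ * volume.withDensity (fun x => ENNReal.ofReal (w x)) J₂) ∧
      (∀ n : ℕ, 2 ≤ n → ∃ C : ℝ, ∀ m k : ℤ, nadicI n m k ⊆ Set.Ico 0 1 →
        (⨍ x in nadicI n m k, w x ^ r) ^ (1 / r) ≤ C * ⨍ x in nadicI n m k, w x) ∧
      ¬ ∃ C : ℝ, ∀ x y : ℝ, 0 ≤ x → x < y → y ≤ 1 →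
        (⨍ t in Set.Ico x y, w t ^ r) ^ (1 / r) ≤ C * ⨍ t in Set.Ico x y, w t := by
  obtain ⟨G, hG1, hG2, hG3⟩ := exists_heights
  have hW := measurable_spikeWeight G
  have h1 := one_le_spikeWeight G
  have hI := integrableOn_spikeWeight hG1
  have hr0 : 0 < r := by linarith
  have hs0 : 0 < 1 / r := by positivity
  have hs1 : 1 / r < 1 := by rwa [div_lt_one hr0]
  have hpow : ∀ x, (spikeWeight G x ^ (1 / r)) ^ r = spikeWeight G x := fun x => by
    rw [← Real.rpow_mul (zero_le_one.trans (h1 x)), one_div_mul_cancel hr0.ne', Real.rpow_one]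
  refine ⟨fun x => spikeWeight G x ^ (1 / r), hW.pow_const _,
    fun x _ => Real.rpow_pos_of_pos (zero_lt_one.trans_le (h1 x)) _,
    integrableOn_rpow_of_one_le hW h1 hs1.le hI, ?_, fun n hn => ?_, fun n hn => ?_, ?_⟩
  · simpa only [hpow] using hI
  · have hn2 : (2 : ℝ) ≤ n := by exact_mod_cast hn
    have hK : (1 : ℝ) ≤ 32 * n := by linarith
    have hC : (1 : ℝ) ≤ 2 * n * (1 + 32 * n) * (32 * n) ^ (1 / r) :=
      one_le_mul_of_one_le_of_one_le (by nlinarith) (Real.one_le_rpow hK hs0.le)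
    refine ⟨2 * n * (1 + 32 * n) * (32 * n) ^ (1 / r), by linarith, ?_⟩
    rintro J₁ J₂ ⟨m, k₁, k₂, k, rfl, rfl, hJ₁, hJ₂⟩ hJ₁' hJ₂'
    rcases nadic_siblings_parent hn hJ₁ hJ₁' hJ₂' with rfl | hJ
    · exact le_mul_of_one_le_left' (ENNReal.one_le_ofReal.2 hC)
    have e₁ := withDensity_ofReal_rpow_apply hW h1 hs1.le (J := nadicI n (m + 1) k₁)
      measurableSet_Ico (hI.mono_set hJ₁')
    have e₂ := withDensity_ofReal_rpow_apply hW h1 hs1.le (J := nadicI n (m + 1) k₂)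
      measurableSet_Ico (hI.mono_set hJ₂')
    beta_reduce
    rw [e₁, e₂, ← ENNReal.ofReal_mul (by linarith)]
    refine ENNReal.ofReal_le_ofReal ?_
    obtain ⟨A, hA⟩ := exists_levelOn hG1 hG2 hn hJ
    have hn0 : (0 : ℝ) < n := by linarith
    have hm : (0 : ℝ) < (n : ℝ) ^ m := by positivity
    have hm1 : (0 : ℝ) < (n : ℝ) ^ (m + 1) := by positivity
    have hlt₂ : ((k₂ : ℝ) - 1) / (n : ℝ) ^ (m + 1) < k₂ / (n : ℝ) ^ (m + 1) := by
      gcongr; linarith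
    obtain ⟨hu₂, hv₂⟩ := (Ico_subset_Ico_iff hlt₂).1 hJ₂
    refine hA.setIntegral_rpow_le_mul (by linarith) hn0.le (by gcongr; linarith) hJ₁ hlt₂.le
      hu₂ hv₂ (le_of_eq ?_) hW h1 hs0.le hs1.le (hI.mono_set hJ)
    rw [zpow_add_one₀ hn0.ne']
    field_simp
    ring
  · have hn2 : (2 : ℝ) ≤ n := by exact_mod_cast hn
    refine ⟨2 * (32 * n * (32 * n)) ^ (1 / r), fun m k hJ => ?_⟩
    obtain ⟨A, hA⟩ := exists_levelOn hG1 hG2 hn hJ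
    simp only [hpow]
    exact hA.reverseHolder (by gcongr; linarith) (by linarith) (by linarith) hW h1 hs0.le hs1.le
      (hI.mono_set hJ)
  · rintro ⟨C, hC⟩
    simp only [hpow] at hC
    obtain ⟨M, hM⟩ := ((tendsto_rpow_atTop (sub_pos.2 hs1)).comp
      tendsto_natCast_atTop_atTop).eventually_gt_atTop (8 * (2 * |C|) ^ r)
      |>.exists_forall_of_atTop
    obtain ⟨k, hk, hMk⟩ := hG3 (max M 2)
    have hG : (2 : ℝ) ≤ G k := by exact_mod_cast (le_max_right M 2).trans hMk
    have hlarge := hM (G k) ((le_max_left M 2).trans hMk)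
    have hE1 : ((1 / 16 : ℝ)) ^ k ≤ 1 / 16 :=
      pow_le_of_le_one (by norm_num) (by norm_num) (by omega)
    obtain ⟨x, y, hx, hxy, hy, hbig, hsmall⟩ :=
      exists_interval_of_spike hG (by positivity) hE1 hs0 hs1
    have hE0 : (0 : ℝ) < (1 / 16) ^ k := by positivity
    have hCxy := hC x y (by linarith) hxy (by linarith)
    have heq : ∀ t ∈ Ico x y, spikeWeight G t = spike (G k) ((1 / 16) ^ k) t := fun t ht =>
      spikeWeight_eq G ⟨hx.trans_le ht.1, ht.2.le.trans hy⟩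
    have e1 : ⨍ t in Ico x y, spikeWeight G t =
        ⨍ t in Ico x y, spike (G k) ((1 / 16) ^ k) t :=
      setAverage_congr_fun measurableSet_Ico (Filter.Eventually.of_forall heq)
    have e2 : ⨍ t in Ico x y, spikeWeight G t ^ (1 / r) =
        ⨍ t in Ico x y, spike (G k) ((1 / 16) ^ k) t ^ (1 / r) :=
      setAverage_congr_fun measurableSet_Ico
        (Filter.Eventually.of_forall fun t ht => by rw [heq t ht])
    rw [e1, e2] at hCxy
    have h0 : 0 ≤ ⨍ t in Ico x y, spike (G k) ((1 / 16) ^ k) t ^ (1 / r) := by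
      rw [setAverage_eq]
      exact smul_nonneg (by positivity) (integral_nonneg fun t =>
        Real.rpow_nonneg (zero_le_one.trans (one_le_spike _ _ t)) _)
    have hle : (((G k : ℝ)) ^ (1 - 1 / r) / 8) ^ (1 / r) ≤ 2 * |C| := by
      calc _ ≤ _ := Real.rpow_le_rpow (by positivity) hbig hs0.le
        _ ≤ _ := hCxy
        _ ≤ |C| * ⨍ t in Ico x y, spike (G k) ((1 / 16) ^ k) t ^ (1 / r) :=
            mul_le_mul_of_nonneg_right (le_abs_self C) h0
        _ ≤ |C| * 2 := by gcongr
        _ = _ := mul_comm _ _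
    have := Real.rpow_le_rpow (by positivity) hle hr0.le
    rw [← Real.rpow_mul (by positivity), one_div_mul_cancel hr0.ne', Real.rpow_one] at this
    simp only [Function.comp_apply] at hlarge
    linarith
end

section
/- For every r with 1 < r < ∞, there exists a measurable weight w : [0,1) → (0,∞), with w and w^{−1/(r−1)} integrable on [0,1), such that for every integer n ≥ 2 the supremum over all n-adic intervals J ⊆ [0,1) of (⨍_J w)·(⨍_J w^{−1/(r−1)})^{r−1} is finite, yet the supremum over all intervals I ⊆ [0,1) of positive length of (⨍_I w)·(⨍_I w^{−1/(r−1)})^{r−1} is infinite. In particular, ∩_{n≥2} A_r^n ⊊ A_r. -/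
open MeasureTheory Set
open scoped ENNReal

/-- Simultaneous approximation: some point of `(0, L)` lies, relative to a scale `ε`, very close to
an `n`-adic grid of mesh at least `2 * ε` for every `n` with `2 ≤ n ≤ N`. -/
theorem exists_near_nadic_grids (N : ℕ) {L η : ℝ} (hL : 0 < L) (hη : 0 < η) :
    ∃ X ε : ℝ, 0 < ε ∧ ε < X ∧ X + ε ≤ L ∧ ∀ n : ℕ, 2 ≤ n → n ≤ N →
      ∃ m a : ℤ, 2 * ε * (n : ℝ) ^ m ≤ 1 ∧ |X - a / (n : ℝ) ^ m| ≤ η * ε := by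
  obtain ⟨K, hK⟩ := exists_nat_gt (2 * N / η)
  have hK0 : (0 : ℝ) < K := lt_of_le_of_lt (by positivity) hK
  have hKpos : 0 < K := by exact_mod_cast hK0
  set M : ℕ := K ^ (N + 1) with hM
  have hMpos : 0 < M := by positivity
  set ε : ℝ := L / (2 * M + 1) with hε
  have hε0 : 0 < ε := by positivity
  have hLε : 2 * ε * M + ε = L := by rw [hε]; field_simp
  have hm : ∀ n : ℕ, ∃ m : ℤ, 2 ≤ n →
      2 * ε * (n : ℝ) ^ m ≤ 1 ∧ 1 < 2 * ε * (n : ℝ) ^ m * n := by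
    intro n
    by_cases hn : 2 ≤ n
    · have hn1 : (1 : ℝ) < n := by exact_mod_cast hn
      obtain ⟨m, h1, h2⟩ := exists_mem_Ico_zpow (x := 1 / (2 * ε)) (by positivity) hn1
      refine ⟨m, fun _ => ⟨?_, ?_⟩⟩
      · rw [le_div_iff₀ (by positivity)] at h1
        linarith
      · rw [div_lt_iff₀ (by positivity), zpow_add_one₀ (by positivity)] at h2
        linarith
    · exact ⟨0, fun h => absurd h hn⟩
  choose m hm using hm
  let p : ℕ → ℕ → ℝ := fun i n => 2 * ε * i * (n : ℝ) ^ m n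
  have hfl : ∀ i n, ⌊(K : ℝ) * Int.fract (p i n)⌋₊ < K := by
    intro i n
    rw [Nat.floor_lt (by positivity [Int.fract_nonneg (p i n)])]
    nlinarith [Int.fract_lt_one (p i n)]
  obtain ⟨i, j, hne, hij⟩ := Fintype.exists_ne_map_eq_of_card_lt
    (fun (i : Fin (M + 1)) (n : Fin (N + 1)) => (⟨_, hfl i n⟩ : Fin K)) (by simp [hM])
  wlog hlt : i < j generalizing i j
  · exact this j i hne.symm hij.symm (lt_of_le_of_ne (not_lt.mp hlt) hne.symm)
  have h1 : (i : ℝ) + 1 ≤ (j : ℝ) := by exact_mod_cast hlt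
  have h2 : (j : ℝ) ≤ M := by exact_mod_cast Nat.lt_succ_iff.mp j.2
  have h0 : (0 : ℝ) ≤ (i : ℝ) := by positivity
  refine ⟨2 * ε * (j - i), ε, hε0, by nlinarith, by nlinarith, fun n hn hnN => ?_⟩
  obtain ⟨hm1, hm2⟩ := hm n hn
  refine ⟨m n, ⌊p j n⌋ - ⌊p i n⌋, hm1, ?_⟩
  have hn0 : (0 : ℝ) < n := by positivity
  have hG : (0 : ℝ) < (n : ℝ) ^ m n := by positivity
  have hnN' : (n : ℝ) ≤ N := by exact_mod_cast hnN
  have hf := congrFun hij ⟨n, by omega⟩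
  simp only [Fin.mk.injEq] at hf
  have key : |Int.fract (p j n) - Int.fract (p i n)| * K ≤ 1 := by
    have a1 := Nat.floor_le (mul_nonneg hK0.le (Int.fract_nonneg (p i n)))
    have a2 := Nat.lt_floor_add_one ((K : ℝ) * Int.fract (p i n))
    have b1 := Nat.floor_le (mul_nonneg hK0.le (Int.fract_nonneg (p j n)))
    have b2 := Nat.lt_floor_add_one ((K : ℝ) * Int.fract (p j n))
    rw [hf] at a1 a2
    have h : |(Int.fract (p j n) - Int.fract (p i n)) * K| ≤ 1 := by
      rw [abs_le]
      constructor <;> linarith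
    rwa [abs_mul, abs_of_pos hK0] at h
  have e : 2 * ε * (j - i) - ((⌊p j n⌋ - ⌊p i n⌋ : ℤ) : ℝ) / (n : ℝ) ^ m n
      = (Int.fract (p j n) - Int.fract (p i n)) / (n : ℝ) ^ m n := by
    simp only [Int.fract, p]
    push_cast
    field_simp
    ring
  rw [e, abs_div, abs_of_pos hG, div_le_iff₀ hG]
  rw [div_lt_iff₀ hη] at hK
  set F := |Int.fract (p j n) - Int.fract (p i n)|
  have hF : 0 ≤ F := abs_nonneg _
  have h3 : 1 ≤ 2 * (n : ℝ) * (ε * (n : ℝ) ^ m n) := by linarith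
  have h4 : 2 * (n : ℝ) * (ε * (n : ℝ) ^ m n) ≤ K * η * (ε * (n : ℝ) ^ m n) := by
    refine mul_le_mul_of_nonneg_right ?_ (by positivity)
    linarith
  have h5 : F * K ≤ (η * ε * (n : ℝ) ^ m n) * K := by linarith
  exact le_of_mul_le_mul_right h5 hK0

/-- An `n`-adic interval cannot be badly unbalanced about a point close to a coarse grid. -/
theorem nadic_unbalanced {n : ℕ} (hn : 2 ≤ n) {X ε θ : ℝ} {m a : ℤ}
    (hm : 2 * ε * (n : ℝ) ^ m ≤ 1) (ha : |X - a / (n : ℝ) ^ m| ≤ θ) (l k : ℤ)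
    (hε : X - ε ≤ (k - 1 : ℝ) / (n : ℝ) ^ l) :
    X - (k - 1 : ℝ) / (n : ℝ) ^ l ≤ θ ∨ (k : ℝ) / (n : ℝ) ^ l - X ≤ θ ∨
      ε ≤ (k : ℝ) / (n : ℝ) ^ l - X := by
  have hn0 : (0 : ℝ) < n := by positivity
  have hn1 : (1 : ℝ) ≤ n := by exact_mod_cast (by omega : 1 ≤ n)
  have hl : (0 : ℝ) < (n : ℝ) ^ l := by positivity
  have hm0 : (0 : ℝ) < (n : ℝ) ^ m := by positivity
  rw [abs_le] at ha
  rcases le_or_gt m l with h | h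
  · obtain ⟨t, rfl⟩ := Int.le.dest h
    have e : (a : ℝ) / (n : ℝ) ^ m = (a * n ^ t : ℤ) / (n : ℝ) ^ (m + t) := by
      rw [zpow_add₀ hn0.ne']
      push_cast
      field_simp
      simp
    rw [e] at ha
    rcases le_or_gt (a * n ^ t) (k - 1) with h' | h'
    · left
      have : ((a * n ^ t : ℤ) : ℝ) / (n : ℝ) ^ (m + t) ≤ (k - 1 : ℝ) / (n : ℝ) ^ (m + t) := by
        gcongr
        exact_mod_cast h'
      linarith
    · right; left
      have : (k : ℝ) / (n : ℝ) ^ (m + t) ≤ ((a * n ^ t : ℤ) : ℝ) / (n : ℝ) ^ (m + t) := by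
        gcongr
        omega
      linarith
  · right; right
    have h1 : (n : ℝ) ^ l ≤ (n : ℝ) ^ m := zpow_le_zpow_right₀ hn1 h.le
    have h2 : 2 * ε ≤ 1 / (n : ℝ) ^ l := by
      rw [le_div_iff₀ hl]
      rcases le_or_gt 0 ε with h0 | h0
      · nlinarith
      · nlinarith
    rw [sub_div] at hε
    linarith

/-- The depth at distance `s` to the left of the right end point of a window of length `ε`. -/
noncomputable def depth (ε ρ s : ℝ) : ℝ := min 1 (max (s / ε) (ρ ^ 2 * ε / s))

theorem depth_le_one (ε ρ s : ℝ) : depth ε ρ s ≤ 1 := min_le_left _ _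

theorem depth_pos {ε s : ℝ} (ρ : ℝ) (hε : 0 < ε) (hs : 0 < s) : 0 < depth ε ρ s :=
  lt_min one_pos (lt_max_of_lt_left (by positivity))

theorem div_le_depth {ε s : ℝ} (ρ : ℝ) (hε : 0 < ε) (hs : s ≤ ε) :
    s / ε ≤ depth ε ρ s :=
  le_min ((div_le_one hε).2 hs) (le_max_left _ _)

theorem sq_le_depth {ε ρ s : ℝ} (hs0 : 0 < s) (hs : s ≤ ε) (hρ0 : 0 ≤ ρ) (hρ : ρ ≤ 1) :
    ρ ^ 2 ≤ depth ε ρ s := by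
  refine le_min (by nlinarith) (le_max_of_le_right ?_)
  rw [le_div_iff₀ hs0]
  gcongr

theorem depth_eq_one {ε ρ s : ℝ} (hs0 : 0 < s) (hs : s ≤ ρ ^ 2 * ε) : depth ε ρ s = 1 :=
  min_eq_left (le_max_of_le_right ((one_le_div hs0).2 hs))

theorem le_depth_mul {ε ρ s d : ℝ} (hs0 : 0 < s) (hd : d ≤ ρ ^ 2 * ε) :
    d ≤ depth ε ρ s * s ∨ depth ε ρ s = 1 := by
  rcases le_or_gt s (ρ ^ 2 * ε) with h | h
  · exact .inr (depth_eq_one hs0 h)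
  · left
    have : ρ ^ 2 * ε / s ≤ depth ε ρ s :=
      le_min ((div_le_one hs0).2 h.le) (le_max_right _ _)
    rw [div_le_iff₀ hs0] at this
    linarith

theorem depth_le_mul_depth {ε ρ s d : ℝ} (hε : 0 < ε) (hs : 0 < s) (hsd : s ≤ d) :
    depth ε ρ d ≤ d / s * depth ε ρ s := by
  have h1 : 1 ≤ d / s := (one_le_div hs).2 hsd
  have hd : 0 < d := hs.trans_le hsd
  unfold depth
  rw [mul_min_of_nonneg _ _ (by positivity), mul_max_of_nonneg _ _ (by positivity)]
  refine min_le_min (by linarith) (max_le_max (le_of_eq (by field_simp)) ?_)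
  calc ρ ^ 2 * ε / d ≤ ρ ^ 2 * ε / s := by gcongr
    _ ≤ d / s * (ρ ^ 2 * ε / s) := le_mul_of_one_le_left (by positivity) h1

theorem depth_le_mul_depth' {ε ρ s d : ℝ} (hε : 0 < ε) (hs : 0 < s) (hsd : s ≤ d) :
    depth ε ρ s ≤ d / s * depth ε ρ d := by
  have h1 : 1 ≤ d / s := (one_le_div hs).2 hsd
  have hd : 0 < d := hs.trans_le hsd
  unfold depth
  rw [mul_min_of_nonneg _ _ (by positivity), mul_max_of_nonneg _ _ (by positivity)]
  refine min_le_min (by linarith) (max_le_max ?_ (le_of_eq (by field_simp)))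
  calc s / ε ≤ d / ε := by gcongr
    _ ≤ d / s * (d / ε) := le_mul_of_one_le_left (by positivity) h1

theorem lintegral_sqrt_div_le {X c d : ℝ} (hc : 0 ≤ c) (hcd : c ≤ d) :
    ∫⁻ x in Ico (X - d) (X - c), ENNReal.ofReal (√(d / (X - x))) ≤
      ENNReal.ofReal (2 * (d - c)) := by
  have hd : 0 ≤ d := hc.trans hcd
  have hint : IntervalIntegrable (fun s : ℝ => √d * s ^ (-(1 / 2) : ℝ)) volume c d :=
    (intervalIntegral.intervalIntegrable_rpow' (by norm_num)).const_mul _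
  have hint2 : IntervalIntegrable (fun x : ℝ => √d * (X - x) ^ (-(1 / 2) : ℝ)) volume
      (X - d) (X - c) := by
    simpa using (hint.comp_sub_left X).symm
  have hval : ∫ x in (X - d)..(X - c), √d * (X - x) ^ (-(1 / 2) : ℝ) ≤ 2 * (d - c) := by
    rw [intervalIntegral.integral_comp_sub_left (fun s => √d * s ^ (-(1 / 2) : ℝ)) X]
    simp only [sub_sub_cancel]
    rw [intervalIntegral.integral_const_mul, integral_rpow (.inl (by norm_num))]
    norm_num
    rw [← Real.sqrt_eq_rpow, ← Real.sqrt_eq_rpow]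
    have h1 := Real.sq_sqrt hd
    have h2 := Real.sq_sqrt hc
    have h3 := Real.sqrt_le_sqrt hcd
    have h4 := Real.sqrt_nonneg c
    nlinarith
  calc ∫⁻ x in Ico (X - d) (X - c), ENNReal.ofReal (√(d / (X - x)))
      = ∫⁻ x in Ico (X - d) (X - c), ENNReal.ofReal (√d * (X - x) ^ (-(1 / 2) : ℝ)) := by
        refine setLIntegral_congr_fun measurableSet_Ico fun x hx => ?_
        have : 0 ≤ X - x := by linarith [hx.2]
        rw [Real.sqrt_div hd, Real.rpow_neg this, ← Real.sqrt_eq_rpow, div_eq_mul_inv]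
    _ = ∫⁻ x in Ioc (X - d) (X - c), ENNReal.ofReal (√d * (X - x) ^ (-(1 / 2) : ℝ)) := by
        rw [restrict_Ico_eq_restrict_Ioc]
    _ = ENNReal.ofReal (∫ x in (X - d)..(X - c), √d * (X - x) ^ (-(1 / 2) : ℝ)) := by
        rw [intervalIntegral.integral_of_le (by linarith), ofReal_integral_eq_lintegral_ofReal]
        · exact (intervalIntegrable_iff_integrableOn_Ioc_of_le (by linarith)).1 hint2
        · refine (ae_restrict_iff' measurableSet_Ioc).2 (.of_forall fun x hx => ?_)
          have : 0 ≤ X - x := by linarith [hx.2]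
          simp only [Pi.zero_apply]
          positivity
    _ ≤ _ := ENNReal.ofReal_le_ofReal hval

/-- Well separated windows `[X k - ε k, X k)` in `[0, 1)`, accumulating to the left. -/
structure SeparatedWindows (X ε ρ : ℕ → ℝ) : Prop where
  pos : ∀ k, 0 < ε k
  lt : ∀ k, ε k < X k
  le_one : ∀ k, X k + ε k ≤ 1
  sep : ∀ i j, i < j → X j + ε j ≤ X i - ε i
  ρ_pos : ∀ k, 0 < ρ k
  ρ_le : ∀ k, ρ k ≤ 1

/-- The `k`-th window. -/
def window (X ε : ℕ → ℝ) (k : ℕ) : Set ℝ := Ico (X k - ε k) (X k)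

open Classical in
/-- The function equal to the depth on each window and to `1` elsewhere. -/
noncomputable def totalDepth (X ε ρ : ℕ → ℝ) (x : ℝ) : ℝ :=
  ⨅ k, if x ∈ window X ε k then depth (ε k) (ρ k) (X k - x) else 1

/-- The square root of the multiplicative discrepancy between `t` and `l`. -/
noncomputable def discrepancy (l t : ℝ) : ℝ := √(max (t / l) (l / t))

theorem discrepancy_self {t : ℝ} (ht : 0 < t) : discrepancy t t = 1 := by
  simp [discrepancy, ht.ne']

theorem discrepancy_le {l t q : ℝ} (hl : 0 < l) (ht : 0 < t) (h1 : t ≤ q * l) (h2 : l ≤ q * t) :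
    discrepancy l t ≤ √q :=
  Real.sqrt_le_sqrt (max_le ((div_le_iff₀ hl).2 h1) ((div_le_iff₀ ht).2 h2))

theorem one_le_discrepancy {l t : ℝ} (hl : 0 < l) (ht : 0 < t) : 1 ≤ discrepancy l t := by
  rw [discrepancy, Real.one_le_sqrt, le_max_iff, one_le_div hl, one_le_div ht]
  exact le_total _ _

theorem discrepancy_sq {l t : ℝ} (hl : 0 < l) (ht : 0 < t) :
    discrepancy l t ^ 2 = max (t / l) (l / t) :=
  Real.sq_sqrt (le_max_of_le_left (by positivity))

theorem rpow_le_mul_discrepancy {l t c : ℝ} (hl : 0 < l) (ht : 0 < t) (hc : |c| ≤ 1 / 2) :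
    t ^ c ≤ l ^ c * discrepancy l t := by
  have h1 := one_le_discrepancy hl ht
  have h2 : ((max (t / l) (l / t)) : ℝ) ^ |c| ≤ discrepancy l t := by
    rw [← discrepancy_sq hl ht, ← Real.rpow_natCast, ← Real.rpow_mul (by linarith)]
    calc _ ≤ discrepancy l t ^ (1 : ℝ) :=
          Real.rpow_le_rpow_of_exponent_le h1 (by push_cast; linarith)
      _ = _ := Real.rpow_one _
  have h3 : (t / l) ^ c ≤ discrepancy l t := by
    refine le_trans ?_ h2
    rcases le_total 0 c with h | h
    · rw [abs_of_nonneg h]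
      exact Real.rpow_le_rpow (by positivity) (le_max_left _ _) h
    · rw [abs_of_nonpos h, ← inv_div l t, Real.inv_rpow (by positivity),
        ← Real.rpow_neg (by positivity)]
      exact Real.rpow_le_rpow (by positivity) (le_max_right _ _) (by linarith)
  rw [Real.div_rpow ht.le hl.le, div_le_iff₀ (by positivity)] at h3
  linarith

namespace SeparatedWindows

variable {X ε ρ : ℕ → ℝ}

theorem disjoint (h : SeparatedWindows X ε ρ) {i j : ℕ} (hij : i ≠ j) :
    Disjoint (window X ε i) (window X ε j) := by
  rw [Set.disjoint_left]
  intro x hi hj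
  have := h.pos i
  have := h.pos j
  rcases lt_or_gt_of_ne hij with hlt | hlt
  · linarith [h.sep _ _ hlt, hi.1, hj.2]
  · linarith [h.sep _ _ hlt, hi.2, hj.1]

theorem totalDepth_of_mem (h : SeparatedWindows X ε ρ) {k : ℕ} {x : ℝ} (hx : x ∈ window X ε k) :
    totalDepth X ε ρ x = depth (ε k) (ρ k) (X k - x) := by
  classical
  have hj : ∀ j, (if x ∈ window X ε j then depth (ε j) (ρ j) (X j - x) else 1) =
      if j = k then depth (ε k) (ρ k) (X k - x) else 1 := by
    intro j
    by_cases hjk : j = k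
    · subst hjk; simp [hx]
    · rw [if_neg hjk, if_neg]
      exact fun hxj => Set.disjoint_left.1 (h.disjoint hjk) hxj hx
  unfold totalDepth
  apply le_antisymm
  · refine (ciInf_le ⟨min 1 (depth (ε k) (ρ k) (X k - x)), ?_⟩ k).trans (by simp [hx])
    rintro _ ⟨j, rfl⟩
    simp only [hj]
    split_ifs
    · exact min_le_right _ _
    · exact min_le_left _ _
  · refine le_ciInf fun j => ?_
    rw [hj]
    split_ifs
    · exact le_rfl
    · exact depth_le_one _ _ _

theorem totalDepth_of_notMem {x : ℝ} (hx : ∀ k, x ∉ window X ε k) :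
    totalDepth X ε ρ x = 1 := by
  simp [totalDepth, hx]

theorem totalDepth_pos (h : SeparatedWindows X ε ρ) (x : ℝ) : 0 < totalDepth X ε ρ x := by
  by_cases hx : ∃ k, x ∈ window X ε k
  · obtain ⟨k, hk⟩ := hx
    rw [h.totalDepth_of_mem hk]
    exact depth_pos _ (h.pos k) (by linarith [hk.2])
  · rw [totalDepth_of_notMem (by simpa using hx)]
    exact one_pos

theorem totalDepth_le_one (h : SeparatedWindows X ε ρ) (x : ℝ) : totalDepth X ε ρ x ≤ 1 := by
  by_cases hx : ∃ k, x ∈ window X ε k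
  · obtain ⟨k, hk⟩ := hx
    rw [h.totalDepth_of_mem hk]
    exact depth_le_one _ _ _
  · rw [totalDepth_of_notMem (by simpa using hx)]

theorem measurable_totalDepth (X ε ρ : ℕ → ℝ) : Measurable (totalDepth X ε ρ) := by
  classical
  refine Measurable.iInf fun k => ?_
  refine Measurable.ite measurableSet_Ico ?_ measurable_const
  unfold depth
  fun_prop

theorem totalDepth_right (h : SeparatedWindows X ε ρ) {k : ℕ} {x : ℝ} (h1 : X k ≤ x)
    (h2 : x < X k + ε k) : totalDepth X ε ρ x = 1 := by
  refine totalDepth_of_notMem fun j hj => ?_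
  rcases lt_trichotomy j k with hlt | rfl | hlt
  · linarith [h.sep _ _ hlt, hj.1]
  · linarith [hj.2]
  · linarith [h.sep _ _ hlt, hj.2, h.pos k, h.pos j]

theorem lintegral_Ico_window_le (h : SeparatedWindows X ε ρ) (k : ℕ) {z : ℝ}
    (hz1 : X k - ε k ≤ z) (hz2 : z ≤ X k) :
    ∫⁻ x in Ico (X k - ε k) z, ENNReal.ofReal (discrepancy 1 (totalDepth X ε ρ x)) ≤
      ENNReal.ofReal (2 * (z - (X k - ε k))) := by
  have key := lintegral_sqrt_div_le (X := X k) (c := X k - z) (d := ε k) (by linarith)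
    (by linarith)
  rw [sub_sub_cancel] at key
  refine (setLIntegral_mono' measurableSet_Ico fun x hx => ENNReal.ofReal_le_ofReal ?_).trans
    (key.trans_eq (by congr 1; ring))
  have hε := h.pos k
  have hmem : x ∈ window X ε k := ⟨hx.1, hx.2.trans_le hz2⟩
  have hs : 0 < X k - x := by linarith [hmem.2]
  have hs' : X k - x ≤ ε k := by linarith [hmem.1]
  rw [h.totalDepth_of_mem hmem]
  refine discrepancy_le one_pos (depth_pos _ hε hs) ?_ ?_
  · have := (one_le_div hs).2 hs'
    linarith [depth_le_one (ε k) (ρ k) (X k - x)]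
  · calc (1 : ℝ) = ε k / (X k - x) * ((X k - x) / ε k) := by field_simp
      _ ≤ _ := by gcongr; exact div_le_depth _ hε hs'

theorem lintegral_Ico_le_of_notMem (h : SeparatedWindows X ε ρ) {y z : ℝ}
    (hy : ∀ k, y ∉ window X ε k) :
    ∫⁻ x in Ico y z, ENNReal.ofReal (discrepancy 1 (totalDepth X ε ρ x)) ≤
      ENNReal.ofReal (2 * (z - y)) := by
  have hmeas : ∀ k, MeasurableSet (window X ε k) := fun k => measurableSet_Ico
  have e : ENNReal.ofReal (2 * (z - y)) = ∫⁻ _ in Ico y z, (2 : ℝ≥0∞) := by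
    rw [setLIntegral_const, Real.volume_Ico, ENNReal.ofReal_mul (by norm_num)]
    simp
  rw [e, ← lintegral_inter_add_sdiff _ _ (MeasurableSet.iUnion hmeas),
    ← lintegral_inter_add_sdiff (fun _ => (2 : ℝ≥0∞)) _ (MeasurableSet.iUnion hmeas)]
  refine add_le_add ?_ ?_
  · have hm : ∀ k, MeasurableSet (Ico y z ∩ window X ε k) := fun k =>
      measurableSet_Ico.inter (hmeas k)
    have hd : Pairwise (Function.onFun Disjoint fun k => Ico y z ∩ window X ε k) :=
      fun i j hij => (h.disjoint hij).mono inter_subset_right inter_subset_right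
    rw [inter_iUnion, lintegral_iUnion hm hd, lintegral_iUnion hm hd]
    refine ENNReal.tsum_le_tsum fun k => ?_
    by_cases hk : X k - ε k ≤ y ∨ z < X k - ε k
    · have : Ico y z ∩ window X ε k = ∅ := by
        rw [eq_empty_iff_forall_notMem]
        rintro x ⟨hx1, hx2⟩
        rcases hk with hk | hk
        · have : X k ≤ y := by
            by_contra hlt
            exact hy k ⟨hk, not_le.1 hlt⟩
          linarith [hx2.2, hx1.1]
        · linarith [hx2.1, hx1.2]
      simp [this]
    · push Not at hk
      have : Ico y z ∩ window X ε k = Ico (X k - ε k) (min z (X k)) := by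
        rw [window, Ico_inter_Ico]
        congr 1
        exact max_eq_right hk.1.le
      rw [this]
      refine (h.lintegral_Ico_window_le k (le_min hk.2 (by linarith [h.pos k]))
        (min_le_right _ _)).trans_eq ?_
      rw [setLIntegral_const, Real.volume_Ico, ENNReal.ofReal_mul (by norm_num)]
      simp
  · refine setLIntegral_mono' (measurableSet_Ico.diff (MeasurableSet.iUnion hmeas)) fun x hx => ?_
    rw [totalDepth_of_notMem (by simpa using hx.2), discrepancy_self one_pos]
    simp

theorem lintegral_Ico_le_of_subset (h : SeparatedWindows X ε ρ) {k : ℕ} {y z : ℝ}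
    (hy : X k - ε k ≤ y) (hyz : y < z) (hz : z ≤ X k) :
    ∫⁻ x in Ico y z, ENNReal.ofReal
      (discrepancy (totalDepth X ε ρ y) (totalDepth X ε ρ x)) ≤
      ENNReal.ofReal (2 * (z - y)) := by
  have key := lintegral_sqrt_div_le (X := X k) (c := X k - z) (d := X k - y) (by linarith)
    (by linarith)
  rw [sub_sub_cancel, sub_sub_cancel] at key
  refine (setLIntegral_mono' measurableSet_Ico fun x hx => ENNReal.ofReal_le_ofReal ?_).trans
    (key.trans_eq (by congr 1; ring))
  have hε := h.pos k
  have hmem : x ∈ window X ε k := ⟨hy.trans hx.1, hx.2.trans_le hz⟩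
  have hs : 0 < X k - x := by linarith [hmem.2]
  have hs' : X k - x ≤ X k - y := by linarith [hx.1]
  refine discrepancy_le (h.totalDepth_pos y) (h.totalDepth_pos x) ?_ ?_
  all_goals rw [h.totalDepth_of_mem hmem, h.totalDepth_of_mem ⟨hy, hyz.trans_le hz⟩]
  · exact depth_le_mul_depth' hε hs hs'
  · exact depth_le_mul_depth hε hs hs'

theorem lintegral_Ico_eq_add {f : ℝ → ℝ≥0∞} {x y z : ℝ} (hxy : x ≤ y) (hyz : y ≤ z) :
    ∫⁻ t in Ico x z, f t = (∫⁻ t in Ico x y, f t) + ∫⁻ t in Ico y z, f t := by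
  rw [← Ico_union_Ico_eq_Ico hxy hyz, lintegral_union measurableSet_Ico]
  rw [Set.disjoint_left]
  exact fun t h1 h2 => by linarith [h1.2, h2.1]

theorem lintegral_Ico_le_of_forall {f : ℝ → ℝ} {x y c : ℝ} (hxy : x ≤ y)
    (hf : ∀ t ∈ Ico x y, f t ≤ c) :
    ∫⁻ t in Ico x y, ENNReal.ofReal (f t) ≤ ENNReal.ofReal (c * (y - x)) := by
  calc _ ≤ ∫⁻ _ in Ico x y, ENNReal.ofReal c :=
        setLIntegral_mono' measurableSet_Ico fun t ht => ENNReal.ofReal_le_ofReal (hf t ht)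
    _ = _ := by
        rw [setLIntegral_const, Real.volume_Ico, ← ENNReal.ofReal_mul' (by linarith)]

/-- On an interval that is balanced in the appropriate sense about every window end point, the
total depth is comparable to a constant on average. -/
theorem exists_lintegral_discrepancy_le (h : SeparatedWindows X ε ρ) {y z C : ℝ} (hyz : y < z)
    (hC : 4 ≤ C)
    (hbal : ∀ k, X k - ε k ≤ y → y < X k → X k < z → 1 / ρ k ≤ C ∨
      X k - y ≤ ρ k ^ 2 * ε k ∨ z - X k ≤ ρ k ^ 2 * ε k ∨ ε k ≤ z - X k) :
    ∃ l : ℝ, 0 < l ∧ ∫⁻ x in Ico y z, ENNReal.ofReal (discrepancy l (totalDepth X ε ρ x)) ≤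
      ENNReal.ofReal (C * (z - y)) := by
  by_cases hy : ∃ k, y ∈ window X ε k
  swap
  · refine ⟨1, one_pos, (h.lintegral_Ico_le_of_notMem (by simpa using hy)).trans
      (ENNReal.ofReal_le_ofReal ?_)⟩
    nlinarith
  obtain ⟨k, hk⟩ := hy
  have hε := h.pos k
  have hρ := h.ρ_pos k
  have hρ1 := h.ρ_le k
  have hρε : ρ k ^ 2 * ε k ≤ ε k := mul_le_of_le_one_left hε.le (by nlinarith)
  have hk1 := hk.1
  have hk2 := hk.2
  rcases le_or_gt z (X k) with hz | hz
  · refine ⟨_, h.totalDepth_pos y, (h.lintegral_Ico_le_of_subset hk.1 hyz hz).trans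
      (ENNReal.ofReal_le_ofReal ?_)⟩
    nlinarith
  have hright := h.lintegral_Ico_le_of_notMem (y := X k) (z := z) (fun j hj => by
    rcases eq_or_ne j k with rfl | hjk
    · exact lt_irrefl _ hj.2
    · rcases lt_or_gt_of_ne hjk with hlt | hlt
      · linarith [h.sep _ _ hlt, hj.1]
      · linarith [h.sep _ _ hlt, hj.2, h.pos j])
  have conclude : ∀ A : ℝ, 0 ≤ A → A + 2 * (z - X k) ≤ C * (z - y) →
      ∫⁻ x in Ico y (X k), ENNReal.ofReal (discrepancy 1 (totalDepth X ε ρ x)) ≤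
        ENNReal.ofReal A →
      ∃ l : ℝ, 0 < l ∧ ∫⁻ x in Ico y z, ENNReal.ofReal (discrepancy l (totalDepth X ε ρ x)) ≤
        ENNReal.ofReal (C * (z - y)) := by
    intro A hA hAC hleft
    refine ⟨1, one_pos, ?_⟩
    rw [lintegral_Ico_eq_add hk2.le hz.le]
    refine (add_le_add hleft hright).trans ?_
    rw [← ENNReal.ofReal_add hA (by linarith)]
    exact ENNReal.ofReal_le_ofReal hAC
  rcases hbal k hk1 hk2 hz with hc | hs | hd | hd
  · refine conclude (1 / ρ k * (X k - y)) (mul_nonneg (by positivity) (by linarith)) ?_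
      (lintegral_Ico_le_of_forall hk2.le fun t ht => ?_)
    · nlinarith
    · have hmem : t ∈ window X ε k := ⟨hk1.trans ht.1, ht.2⟩
      have hs : 0 < X k - t := by linarith [ht.2]
      rw [h.totalDepth_of_mem hmem]
      have h1 := sq_le_depth (ε := ε k) hs (by linarith [hmem.1]) hρ.le hρ1
      refine (discrepancy_le (q := (1 / ρ k) ^ 2) one_pos (depth_pos _ hε hs) ?_ ?_).trans_eq
        (Real.sqrt_sq (by positivity))
      · have : 1 ≤ (1 / ρ k) ^ 2 := one_le_pow₀ ((one_le_div hρ).2 hρ1)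
        linarith [depth_le_one (ε k) (ρ k) (X k - t)]
      · calc (1 : ℝ) = (1 / ρ k) ^ 2 * ρ k ^ 2 := by field_simp
          _ ≤ _ := by gcongr
  · refine conclude (1 * (X k - y)) (by linarith) (by nlinarith)
      (lintegral_Ico_le_of_forall hk2.le fun t ht => ?_)
    rw [h.totalDepth_of_mem ⟨hk1.trans ht.1, ht.2⟩,
      depth_eq_one (by linarith [ht.2]) (by linarith [ht.1]), discrepancy_self one_pos]
  · have hl := h.totalDepth_pos y
    refine ⟨_, hl, ?_⟩
    rw [lintegral_Ico_eq_add hk2.le hz.le]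
    have hr : ∫⁻ x in Ico (X k) z, ENNReal.ofReal
        (discrepancy (totalDepth X ε ρ y) (totalDepth X ε ρ x)) ≤ ENNReal.ofReal (z - y) := by
      refine (lintegral_Ico_le_of_forall (c := 1 / totalDepth X ε ρ y) hz.le
        fun t ht => ?_).trans (ENNReal.ofReal_le_ofReal ?_)
      · have h1 := h.totalDepth_le_one y
        have h2 : 1 ≤ 1 / totalDepth X ε ρ y := (one_le_div hl).2 h1
        rw [h.totalDepth_right ht.1 (by linarith [ht.2])]
        refine (discrepancy_le (q := (1 / totalDepth X ε ρ y) ^ 2) hl one_pos ?_ ?_).trans_eq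
          (Real.sqrt_sq (by positivity))
        · rw [sq, mul_assoc, one_div_mul_cancel hl.ne']
          linarith
        · nlinarith
      · rw [h.totalDepth_of_mem hk, one_div, inv_mul_le_iff₀ (by rwa [← h.totalDepth_of_mem hk])]
        rcases le_depth_mul (s := X k - y) (by linarith) hd with h1 | h1
        · have := depth_pos (ρ k) hε (show 0 < X k - y by linarith)
          nlinarith
        · rw [h1]
          linarith
    refine (add_le_add (h.lintegral_Ico_le_of_subset hk1 hk2 le_rfl) hr).trans ?_
    rw [← ENNReal.ofReal_add (by linarith) (by linarith)]
    refine ENNReal.ofReal_le_ofReal ?_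
    nlinarith
  · refine conclude (2 * ε k) (by linarith) (by nlinarith) ?_
    calc _ ≤ ∫⁻ x in Ico (X k - ε k) (X k),
          ENNReal.ofReal (discrepancy 1 (totalDepth X ε ρ x)) :=
          lintegral_mono_set (Ico_subset_Ico_left hk1)
      _ ≤ _ := (h.lintegral_Ico_window_le k (by linarith) le_rfl).trans_eq
          (by rw [sub_sub_cancel])

end SeparatedWindows

theorem exists_separatedWindows_near_grids : ∃ X ε : ℕ → ℝ,
    SeparatedWindows X ε (fun k => 1 / ((k : ℝ) + 2)) ∧ ∀ k n : ℕ, 2 ≤ n → n ≤ k →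
      ∃ m a : ℤ, 2 * ε k * (n : ℝ) ^ m ≤ 1 ∧
        |X k - a / (n : ℝ) ^ m| ≤ (1 / ((k : ℝ) + 2)) ^ 2 * ε k := by
  have step : ∀ (k : ℕ) (L : {L : ℝ // 0 < L}), ∃ X ε : ℝ, 0 < ε ∧ ε < X ∧ X + ε ≤ L ∧
      ∀ n : ℕ, 2 ≤ n → n ≤ k → ∃ m a : ℤ, 2 * ε * (n : ℝ) ^ m ≤ 1 ∧
        |X - a / (n : ℝ) ^ m| ≤ (1 / ((k : ℝ) + 2)) ^ 2 * ε :=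
    fun k L => exists_near_nadic_grids k L.2 (by positivity)
  choose X ε h1 h2 h3 h4 using step
  let L : ℕ → {L : ℝ // 0 < L} := fun k => Nat.rec ⟨1, one_pos⟩
    (fun k L => ⟨X k L - ε k L, sub_pos.2 (h2 k L)⟩) k
  have hL : ∀ k, (L (k + 1) : ℝ) = X k (L k) - ε k (L k) := fun _ => rfl
  have hanti : Antitone (fun k : ℕ => ((L k).1 : ℝ)) := antitone_nat_of_succ_le fun k => by
    linarith [hL k, h1 k (L k), h3 k (L k)]
  refine ⟨fun k => X k (L k), fun k => ε k (L k), ⟨fun k => h1 _ _, fun k => h2 _ _, fun k => ?_,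
    fun i j hij => ?_, fun k => by positivity, fun k => ?_⟩, fun k => h4 k (L k)⟩
  · have h0 : (L 0).1 = 1 := rfl
    linarith [h3 k (L k), hanti (Nat.zero_le k)]
  · linarith [h3 j (L j), hL i, hanti (Nat.succ_le_of_lt hij)]
  · rw [div_le_one (by positivity)]
    linarith [(Nat.cast_nonneg k : (0 : ℝ) ≤ k)]

theorem setAverage_Ico_le {g D : ℝ → ℝ} {y z c C : ℝ} (hyz : y < z) (hg : Measurable g)
    (hg0 : ∀ x, 0 ≤ g x) (hc : 0 ≤ c) (hC : 0 ≤ C) (hgD : ∀ x, g x ≤ c * D x)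
    (hD : ∫⁻ x in Ico y z, ENNReal.ofReal (D x) ≤ ENNReal.ofReal (C * (z - y))) :
    ⨍ x in Ico y z, g x ≤ c * C := by
  have hint : ∫ x in Ico y z, g x ≤ c * (C * (z - y)) := by
    rw [integral_eq_lintegral_of_nonneg_ae (.of_forall hg0) hg.aestronglyMeasurable]
    refine ENNReal.toReal_le_of_le_ofReal (mul_nonneg hc (mul_nonneg hC (by linarith))) ?_
    calc ∫⁻ x in Ico y z, ENNReal.ofReal (g x)
        ≤ ∫⁻ x in Ico y z, ENNReal.ofReal c * ENNReal.ofReal (D x) :=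
          lintegral_mono fun x => by
            rw [← ENNReal.ofReal_mul hc]
            exact ENNReal.ofReal_le_ofReal (hgD x)
      _ = ENNReal.ofReal c * ∫⁻ x in Ico y z, ENNReal.ofReal (D x) :=
          lintegral_const_mul' _ _ ENNReal.ofReal_ne_top
      _ ≤ _ := by
          rw [ENNReal.ofReal_mul hc]
          gcongr
  rw [setAverage_eq, smul_eq_mul, Measure.real, Real.volume_Ico,
    ENNReal.toReal_ofReal (by linarith), inv_mul_le_iff₀ (by linarith)]
  linarith

theorem le_setAverage_Ico {g : ℝ → ℝ} {x y p q c κ : ℝ} (hg : IntegrableOn g (Ico x y))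
    (hg0 : ∀ t, 0 ≤ g t) (hc : 0 ≤ c) (hxy : x < y) (hxp : x ≤ p) (hpq : p ≤ q) (hqy : q ≤ y)
    (hgc : ∀ t ∈ Ico p q, c ≤ g t) (hκ : κ * (y - x) ≤ q - p) :
    κ * c ≤ ⨍ t in Ico x y, g t := by
  have hsub : Ico p q ⊆ Ico x y := Ico_subset_Ico hxp hqy
  have h1 : c * (q - p) ≤ ∫ t in Ico p q, g t := by
    have := setIntegral_mono_on (integrableOn_const (C := c) (by simp)) (hg.mono_set hsub)
      measurableSet_Ico hgc
    rw [setIntegral_const, Measure.real, Real.volume_Ico, ENNReal.toReal_ofReal (by linarith),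
      smul_eq_mul] at this
    linarith
  have h2 : ∫ t in Ico p q, g t ≤ ∫ t in Ico x y, g t :=
    setIntegral_mono_set hg (.of_forall hg0) hsub.eventuallyLE
  rw [setAverage_eq, smul_eq_mul, Measure.real, Real.volume_Ico,
    ENNReal.toReal_ofReal (by linarith), le_inv_mul_iff₀ (by linarith)]
  nlinarith

namespace SeparatedWindows

variable {X ε ρ : ℕ → ℝ}

theorem integrableOn_totalDepth_rpow (h : SeparatedWindows X ε ρ) {c : ℝ} (hc : |c| ≤ 1 / 2) :
    IntegrableOn (fun x => totalDepth X ε ρ x ^ c) (Ico 0 1) := by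
  refine ⟨((measurable_totalDepth X ε ρ).pow_const c).aestronglyMeasurable, ?_⟩
  rw [hasFiniteIntegral_iff_ofReal (.of_forall fun x => (Real.rpow_pos_of_pos
    (h.totalDepth_pos x) c).le)]
  refine lt_of_le_of_lt (lintegral_mono fun x => ENNReal.ofReal_le_ofReal ?_)
    ((h.lintegral_Ico_le_of_notMem (y := 0) (z := 1) fun k hk => ?_).trans_lt
      ENNReal.ofReal_lt_top)
  · simpa using rpow_le_mul_discrepancy one_pos (h.totalDepth_pos x) hc
  · linarith [hk.1, h.lt k]

theorem setAverage_mul_le (h : SeparatedWindows X ε ρ) {a c p l y z C : ℝ} (hyz : y < z)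
    (hl : 0 < l) (hC : 0 ≤ C) (hp : 0 ≤ p) (ha : |a| ≤ 1 / 2) (hc : |c| ≤ 1 / 2)
    (hacp : a + c * p = 0)
    (hD : ∫⁻ x in Ico y z, ENNReal.ofReal (discrepancy l (totalDepth X ε ρ x)) ≤
      ENNReal.ofReal (C * (z - y))) :
    (⨍ x in Ico y z, totalDepth X ε ρ x ^ a) * (⨍ x in Ico y z, totalDepth X ε ρ x ^ c) ^ p ≤
      C * C ^ p := by
  have av : ∀ e : ℝ, |e| ≤ 1 / 2 → ⨍ x in Ico y z, totalDepth X ε ρ x ^ e ≤ l ^ e * C :=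
    fun e he => setAverage_Ico_le hyz ((measurable_totalDepth X ε ρ).pow_const e)
      (fun x => (Real.rpow_pos_of_pos (h.totalDepth_pos x) e).le) (by positivity) hC
      (fun x => rpow_le_mul_discrepancy hl (h.totalDepth_pos x) he) hD
  have av0 : ∀ e : ℝ, 0 ≤ ⨍ x in Ico y z, totalDepth X ε ρ x ^ e := fun e => by
    rw [setAverage_eq, smul_eq_mul]
    exact mul_nonneg (by positivity) (integral_nonneg fun x =>
      (Real.rpow_pos_of_pos (h.totalDepth_pos x) e).le)
  calc _ ≤ (l ^ a * C) * (l ^ c * C) ^ p := by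
        gcongr
        · exact Real.rpow_nonneg (av0 c) _
        · exact av a ha
        · exact av0 c
        · exact av c hc
    _ = l ^ (a + c * p) * (C * C ^ p) := by
        rw [Real.mul_rpow (by positivity) hC, ← Real.rpow_mul hl.le, Real.rpow_add hl]
        ring
    _ = _ := by rw [hacp, Real.rpow_zero, one_mul]

theorem le_setAverage_mul (h : SeparatedWindows X ε ρ) {a c p : ℝ} (hp : 0 ≤ p)
    (ha : |a| ≤ 1 / 2) (hc : |c| ≤ 1 / 2) (hc0 : c ≤ 0) (hacp : a + c * p = 0) (k : ℕ) :
    1 / 2 * ((1 / 4) ^ p * (2 * ρ k) ^ (-a)) ≤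
      (⨍ x in Ico (X k - ρ k * ε k) (X k + ρ k * ε k), totalDepth X ε ρ x ^ a) *
      (⨍ x in Ico (X k - ρ k * ε k) (X k + ρ k * ε k), totalDepth X ε ρ x ^ c) ^ p := by
  have hε := h.pos k
  have hρ := h.ρ_pos k
  have hρε : ρ k * ε k ≤ ε k := mul_le_of_le_one_left hε.le (h.ρ_le k)
  have hs : 0 < ρ k * ε k := by positivity
  have hlt := h.lt k
  have hle := h.le_one k
  have hsub : Ico (X k - ρ k * ε k) (X k + ρ k * ε k) ⊆ Ico 0 1 :=
    Ico_subset_Ico (by linarith) (by linarith)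
  have hpos : ∀ (e x : ℝ), 0 ≤ totalDepth X ε ρ x ^ e :=
    fun e x => (Real.rpow_pos_of_pos (h.totalDepth_pos x) e).le
  have h1 : 1 / 2 * 1 ≤
      ⨍ x in Ico (X k - ρ k * ε k) (X k + ρ k * ε k), totalDepth X ε ρ x ^ a := by
    refine le_setAverage_Ico (p := X k) (q := X k + ρ k * ε k)
      ((h.integrableOn_totalDepth_rpow ha).mono_set hsub) (hpos a) zero_le_one (by linarith)
      (by linarith) (by linarith) le_rfl (fun t ht => ?_) (by linarith)
    rw [h.totalDepth_right ht.1 (by linarith [ht.2]), Real.one_rpow]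
  have h2 : 1 / 4 * (2 * ρ k) ^ c ≤
      ⨍ x in Ico (X k - ρ k * ε k) (X k + ρ k * ε k), totalDepth X ε ρ x ^ c := by
    refine le_setAverage_Ico (p := X k - ρ k * ε k) (q := X k - ρ k * ε k / 2)
      ((h.integrableOn_totalDepth_rpow hc).mono_set hsub) (hpos c) (by positivity) (by linarith)
      le_rfl (by linarith) (by linarith) (fun t ht => ?_) (by linarith)
    refine Real.rpow_le_rpow_of_nonpos (h.totalDepth_pos t) ?_ hc0
    have ht1 := ht.1
    have ht2 := ht.2
    rw [h.totalDepth_of_mem ⟨by linarith, by linarith⟩]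
    refine (min_le_right _ _).trans (max_le ?_ ?_)
    · rw [div_le_iff₀ hε]
      nlinarith
    · rw [div_le_iff₀ (by linarith)]
      nlinarith
  calc _ = (1 / 2 * 1) * (1 / 4 * (2 * ρ k) ^ c) ^ p := by
        rw [Real.mul_rpow (x := 1 / 4) (by norm_num) (by positivity),
          ← Real.rpow_mul (by positivity), show c * p = -a by linarith, mul_one]
    _ ≤ _ := by gcongr

end SeparatedWindows

/-- Theorem 1.3, part 2: `⋂_{n ≥ 2} A_r^n ⊊ A_r`. There is a weight on
`[0,1)` whose Muckenhoupt `A_r` characteristic is finite over `n`-adic intervals for every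
`n ≥ 2`, but infinite over arbitrary intervals. -/
theorem nadic_muckenhoupt_intersection_ne (r : ℝ) (hr : 1 < r) :
    ∃ w : ℝ → ℝ, Measurable w ∧ (∀ x ∈ Set.Ico (0:ℝ) 1, 0 < w x) ∧
      IntegrableOn w (Set.Ico 0 1) ∧
      IntegrableOn (fun x => w x ^ (-(1:ℝ) / (r - 1))) (Set.Ico 0 1) ∧
      (∀ n : ℕ, 2 ≤ n → ∃ C : ℝ, ∀ m k : ℤ, nadicI n m k ⊆ Set.Ico 0 1 →
        (⨍ x in nadicI n m k, w x) *
          (⨍ x in nadicI n m k, w x ^ (-(1:ℝ) / (r - 1))) ^ (r - 1) ≤ C) ∧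
      (∀ C : ℝ, ∃ x y : ℝ, 0 ≤ x ∧ x < y ∧ y ≤ 1 ∧
        C < (⨍ t in Set.Ico x y, w t) *
          (⨍ t in Set.Ico x y, w t ^ (-(1:ℝ) / (r - 1))) ^ (r - 1)) := by
  obtain ⟨X, ε, h, hgrid⟩ := exists_separatedWindows_near_grids
  set ρ : ℕ → ℝ := fun k => 1 / ((k : ℝ) + 2) with hρ
  have hr0 : 0 < r - 1 := by linarith
  obtain ⟨a, ha0, ha1, har⟩ : ∃ a : ℝ, 0 < a ∧ a ≤ 1 / 2 ∧ a ≤ 1 / 2 * (r - 1) :=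
    ⟨1 / 2 * min 1 (r - 1), mul_pos (by norm_num) (lt_min one_pos hr0),
      by linarith [min_le_left 1 (r - 1)], by linarith [min_le_right 1 (r - 1)]⟩
  have ha : |a| ≤ 1 / 2 := by rwa [abs_of_pos ha0]
  set c : ℝ := a * (-(1 : ℝ) / (r - 1)) with hc_def
  have hacp : a + c * (r - 1) = 0 := by rw [hc_def]; field_simp; ring
  have hc0 : c ≤ 0 := by nlinarith
  have hc : |c| ≤ 1 / 2 := by
    rw [abs_of_nonpos hc0]
    nlinarith
  have hw : ∀ x, (totalDepth X ε ρ x ^ a) ^ (-(1 : ℝ) / (r - 1)) = totalDepth X ε ρ x ^ c :=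
    fun x => (Real.rpow_mul (h.totalDepth_pos x).le _ _).symm
  refine ⟨fun x => totalDepth X ε ρ x ^ a,
    (SeparatedWindows.measurable_totalDepth X ε ρ).pow_const a,
    fun x _ => Real.rpow_pos_of_pos (h.totalDepth_pos x) a, h.integrableOn_totalDepth_rpow ha,
    ?_, ?_, ?_⟩
  all_goals simp only [hw]
  · exact h.integrableOn_totalDepth_rpow hc
  · intro n hn
    refine ⟨((n : ℝ) + 4) * ((n : ℝ) + 4) ^ (r - 1), fun m k _ => ?_⟩
    have hn0 : (0 : ℝ) < n := by positivity
    have hyz : (k - 1 : ℝ) / (n : ℝ) ^ m < (k : ℝ) / (n : ℝ) ^ m := by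
      gcongr
      linarith
    obtain ⟨l, hl, hD⟩ := h.exists_lintegral_discrepancy_le (C := (n : ℝ) + 4) hyz
      (by linarith) (fun j h1 h2 h3 => by
        rcases lt_or_ge j n with hj | hj
        · left
          have : (j : ℝ) ≤ n := by exact_mod_cast hj.le
          simp only [hρ, one_div_one_div]
          linarith
        · right
          obtain ⟨m', a', hm', ha'⟩ := hgrid j n hn hj
          exact nadic_unbalanced hn hm' ha' m k h1)
    exact h.setAverage_mul_le hyz hl (by positivity) hr0.le ha hc hacp hD
  · intro C
    have hlim : Filter.Tendsto (fun k : ℕ => 1 / 2 * ((1 / 4) ^ (r - 1) * (2 * ρ k) ^ (-a)))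
        Filter.atTop Filter.atTop := by
      refine Filter.Tendsto.const_mul_atTop (by norm_num)
        (Filter.Tendsto.const_mul_atTop (by positivity) ?_)
      have e : ∀ k : ℕ, (2 * ρ k) ^ (-a) = (((k : ℝ) + 2) / 2) ^ a := fun k => by
        rw [Real.rpow_neg (by positivity), ← Real.inv_rpow (by positivity)]
        congr 1
        simp only [hρ]
        field_simp
      simp only [e]
      exact (tendsto_rpow_atTop ha0).comp (Filter.Tendsto.atTop_div_const (by norm_num)
        (Filter.tendsto_atTop_add_const_right _ _ tendsto_natCast_atTop_atTop))
    obtain ⟨k, hk⟩ := (hlim.eventually_gt_atTop C).exists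
    have hε := h.pos k
    have hρε : ρ k * ε k ≤ ε k := mul_le_of_le_one_left hε.le (h.ρ_le k)
    have hs : 0 < ρ k * ε k := mul_pos (h.ρ_pos k) hε
    exact ⟨X k - ρ k * ε k, X k + ρ k * ε k, by linarith [h.lt k], by linarith,
      by linarith [h.le_one k],
      hk.trans_le (h.le_setAverage_mul hr0.le ha hc hc0 hacp k)⟩
end

section
/- Let μ be the absolutely continuous Borel measure on [−1,1) with density f given by f(x) = 1 for x ∈ [−1,0) and f(x) = x for x ∈ [0,1). Then: (1) for every integer n ≥ 2, μ is n-adic doubling on [−1,1) with constant 2n−1, i.e., μ(J₁) ≤ (2n−1)·μ(J₂) for all n-adic siblings J₁, J₂ ⊆ [−1,1); (2) this constant is attained: for every k ≥ 1, with J₁ = [(n−1)/n^k, n/n^k) and J₂ = [0, 1/n^k), one has μ(J₁)/μ(J₂) = 2n−1; and (3) μ is not doubling: for every C > 0 there exist adjacent intervals I₁, I₂ ⊆ [−1,1) of equal positive length with μ(I₁) > C·μ(I₂). -/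
open MeasureTheory Set
open scoped ENNReal

/-- The measure on `[-1,1)` with density `1` on `[-1,0)` and `x` on `[0,1)`. -/
noncomputable def linearDensityMeasure : Measure ℝ :=
  (volume.restrict (Set.Ico (-1) 1)).withDensity
    (fun x => ENNReal.ofReal (if x < 0 then 1 else x))

lemma linearDensityMeasure_Ico_of_subset {a b : ℝ} (ha : -1 ≤ a) (hb : b ≤ 1) :
    linearDensityMeasure (Ico a b) =
      ∫⁻ x in Ico a b, ENNReal.ofReal (if x < 0 then 1 else x) := by
  rw [linearDensityMeasure, withDensity_apply _ measurableSet_Ico,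
    Measure.restrict_restrict measurableSet_Ico,
    inter_eq_left.mpr (Ico_subset_Ico ha hb)]

lemma linearDensityMeasure_Ico_of_nonpos {a b : ℝ} (ha : -1 ≤ a) (hb : b ≤ 0) :
    linearDensityMeasure (Ico a b) = ENNReal.ofReal (b - a) := by
  rw [linearDensityMeasure_Ico_of_subset ha (hb.trans zero_le_one),
    setLIntegral_congr_fun (g := fun _ => 1) measurableSet_Ico]
  · simp
  · intro x hx
    simp [hx.2.trans_le hb]

lemma linearDensityMeasure_Ico_of_nonneg {a b : ℝ} (ha : 0 ≤ a) (hab : a ≤ b) (hb : b ≤ 1) :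
    linearDensityMeasure (Ico a b) = ENNReal.ofReal ((b ^ 2 - a ^ 2) / 2) := by
  rw [linearDensityMeasure_Ico_of_subset (by linarith) hb,
    setLIntegral_congr_fun (g := fun x => ENNReal.ofReal x) measurableSet_Ico]
  · rw [restrict_Ico_eq_restrict_Ioc, ← integral_id,
      intervalIntegral.integral_of_le hab, ofReal_integral_eq_lintegral_ofReal]
    · exact (continuous_id.intervalIntegrable a b).1
    · filter_upwards [ae_restrict_mem measurableSet_Ioc] with x hx
      exact ha.trans hx.1.le
  · intro x hx
    simp [not_lt.mpr (ha.trans hx.1)]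

lemma nadicI_subset_nadicI_iff {n : ℕ} (hn : 0 < n) {m k l : ℤ} :
    nadicI n (m + 1) l ⊆ nadicI n m k ↔ n * (k - 1) ≤ l - 1 ∧ l ≤ n * k := by
  have hn' : (0 : ℝ) < n := by exact_mod_cast hn
  have hp : (0 : ℝ) < (n : ℝ) ^ m := zpow_pos hn' m
  have hscale (x : ℝ) : x / (n : ℝ) ^ m = n * x / (n : ℝ) ^ (m + 1) := by
    rw [zpow_add_one₀ hn'.ne']
    field_simp
  have hq : (0 : ℝ) < (n : ℝ) ^ (m + 1) := zpow_pos hn' _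
  unfold nadicI
  rw [Ico_subset_Ico_iff (by gcongr; linarith), hscale, hscale,
    div_le_div_iff_of_pos_right hq, div_le_div_iff_of_pos_right hq]
  norm_cast

lemma linearDensityMeasure_le_of_nadicSiblings {n : ℕ} (hn : 2 ≤ n) {J₁ J₂ : Set ℝ}
    (hJ : NAdicSiblings n J₁ J₂) (h₁ : J₁ ⊆ Ico (-1) 1) (h₂ : J₂ ⊆ Ico (-1) 1) :
    linearDensityMeasure J₁ ≤ ENNReal.ofReal (2 * n - 1) * linearDensityMeasure J₂ := by
  obtain ⟨m, k₁, k₂, k, rfl, rfl, hk₁, hk₂⟩ := hJ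
  rw [nadicI_subset_nadicI_iff (by omega)] at hk₁ hk₂
  have hn' : (2 : ℝ) ≤ n := by exact_mod_cast hn
  unfold nadicI at *
  have hq : (0 : ℝ) < (n : ℝ) ^ (m + 1) := zpow_pos (by linarith) _
  generalize (n : ℝ) ^ (m + 1) = q at *
  rw [Ico_subset_Ico_iff (by gcongr; linarith)] at h₁ h₂
  rcases le_or_gt k 0 with hk | hk
  · have hnk : (n : ℤ) * k ≤ 0 := mul_nonpos_of_nonneg_of_nonpos (by omega) hk
    have hle (l : ℤ) (hl : l ≤ n * k) : (l : ℝ) / q ≤ 0 :=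
      div_nonpos_of_nonpos_of_nonneg (by exact_mod_cast hl.trans hnk) hq.le
    rw [linearDensityMeasure_Ico_of_nonpos h₁.1 (hle _ hk₁.2),
      linearDensityMeasure_Ico_of_nonpos h₂.1 (hle _ hk₂.2),
      ← ENNReal.ofReal_mul (by linarith)]
    apply ENNReal.ofReal_le_ofReal
    have h (x : ℝ) : x / q - (x - 1) / q = 1 / q := by ring
    rw [h, h]
    exact le_mul_of_one_le_left (by positivity) (by linarith)
  · have hnk : 0 ≤ (n : ℤ) * (k - 1) := mul_nonneg (by omega) (by omega)
    have hge (l : ℤ) (hl : n * (k - 1) ≤ l - 1) : 0 ≤ ((l : ℝ) - 1) / q :=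
      div_nonneg (by exact_mod_cast hnk.trans hl) hq.le
    rw [linearDensityMeasure_Ico_of_nonneg (hge _ hk₁.1) (by gcongr; linarith) h₁.2,
      linearDensityMeasure_Ico_of_nonneg (hge _ hk₂.1) (by gcongr; linarith) h₂.2,
      ← ENNReal.ofReal_mul (by linarith)]
    apply ENNReal.ofReal_le_ofReal
    have h (x : ℝ) : ((x / q) ^ 2 - ((x - 1) / q) ^ 2) / 2 = (2 * x - 1) / (2 * q ^ 2) := by
      field_simp
      ring
    rw [h, h, ← mul_div_assoc]
    have hk₂_pos : (1 : ℝ) ≤ k₂ := by exact_mod_cast (by omega : 1 ≤ k₂)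
    have hdist : (k₁ : ℝ) ≤ k₂ + n - 1 := by
      have : k₁ ≤ k₂ + n - 1 := by linarith
      exact_mod_cast this
    gcongr
    nlinarith

lemma linearDensityMeasure_Ico_last {n k : ℕ} (hn : 1 ≤ n) (hk : 1 ≤ k) :
    linearDensityMeasure (Ico (((n : ℝ) - 1) / (n : ℝ) ^ k) ((n : ℝ) / (n : ℝ) ^ k)) =
      ENNReal.ofReal (2 * n - 1) * linearDensityMeasure (Ico 0 (1 / (n : ℝ) ^ k)) := by
  have hn' : (1 : ℝ) ≤ n := by exact_mod_cast hn
  have hq : (n : ℝ) ≤ (n : ℝ) ^ k := le_self_pow₀ hn' (by omega)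
  generalize (n : ℝ) ^ k = q at *
  have hq_pos : 0 < q := by linarith
  rw [linearDensityMeasure_Ico_of_nonneg (div_nonneg (by linarith) hq_pos.le)
      (by gcongr; linarith) ((div_le_one hq_pos).mpr hq),
    linearDensityMeasure_Ico_of_nonneg le_rfl (by positivity)
      ((div_le_one hq_pos).mpr (hn'.trans hq)),
    ← ENNReal.ofReal_mul (by linarith)]
  congr 1
  ring

lemma exists_adjacentPair_linearDensityMeasure_lt {C : ℝ} (hC : 0 < C) :
    ∃ I₁ I₂ : Set ℝ, AdjacentPair I₁ I₂ ∧ I₁ ⊆ Ico (-1) 1 ∧ I₂ ⊆ Ico (-1) 1 ∧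
      ENNReal.ofReal C * linearDensityMeasure I₂ < linearDensityMeasure I₁ := by
  obtain ⟨l, hl, hl_one, hCl⟩ : ∃ l : ℝ, 0 < l ∧ l ≤ 1 ∧ C * l < 1 := by
    refine ⟨1 / (C + 1), by positivity, ?_, ?_⟩
    · rw [div_le_one (by positivity)]
      linarith
    · rw [mul_one_div, div_lt_one (by positivity)]
      linarith
  refine ⟨Ico (0 - l) 0, Ico 0 (0 + l), ⟨0, l, hl, Or.inl ⟨rfl, rfl⟩⟩,
    Ico_subset_Ico (by linarith) zero_le_one,
    Ico_subset_Ico (by norm_num) (by linarith), ?_⟩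
  rw [linearDensityMeasure_Ico_of_nonpos (by linarith) le_rfl,
    linearDensityMeasure_Ico_of_nonneg le_rfl (by linarith) (by linarith),
    ← ENNReal.ofReal_mul hC.le]
  apply (ENNReal.ofReal_lt_ofReal_iff (by linarith)).mpr
  nlinarith

/-- motivating example: the measure on `[-1,1)` with density `1` on
`[-1,0)` and `x` on `[0,1)` is `n`-adic doubling with constant `2n-1` for every `n ≥ 2`
(the constant being attained at `J₁ = [(n-1)/n^k, n/n^k)`, `J₂ = [0, 1/n^k)`), yet it is
not doubling. -/
theorem motivating_example_linear_density
    (μ : Measure ℝ)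
    (hμ : μ = (volume.restrict (Set.Ico (-1) 1)).withDensity
      (fun x => ENNReal.ofReal (if x < 0 then 1 else x))) :
    (∀ n : ℕ, 2 ≤ n →
      (∀ J₁ J₂ : Set ℝ, NAdicSiblings n J₁ J₂ →
        J₁ ⊆ Set.Ico (-1) 1 → J₂ ⊆ Set.Ico (-1) 1 →
        μ J₁ ≤ ENNReal.ofReal (2 * n - 1) * μ J₂) ∧
      (∀ k : ℕ, 1 ≤ k →
        μ (Set.Ico (((n : ℝ) - 1) / (n : ℝ) ^ k) ((n : ℝ) / (n : ℝ) ^ k)) =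
          ENNReal.ofReal (2 * n - 1) * μ (Set.Ico 0 (1 / (n : ℝ) ^ k)))) ∧
    (∀ C : ℝ, 0 < C → ∃ I₁ I₂ : Set ℝ, AdjacentPair I₁ I₂ ∧
      I₁ ⊆ Set.Ico (-1) 1 ∧ I₂ ⊆ Set.Ico (-1) 1 ∧ ENNReal.ofReal C * μ I₂ < μ I₁) := by
  change μ = linearDensityMeasure at hμ
  subst hμ
  exact ⟨fun n hn => ⟨fun _ _ => linearDensityMeasure_le_of_nadicSiblings hn,
    fun k hk => linearDensityMeasure_Ico_last (by omega) hk⟩,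
    fun C hC => exists_adjacentPair_linearDensityMeasure_lt hC⟩
end

section
/- Let μ be the absolutely continuous Borel measure on [−1,1) with density f given by f(x) = 1 for x ∈ [−1,0) and f(x) = 2^{−k} for x ∈ [2^{−k}, 2^{−k+1}) for each integer k ≥ 1. Then for every integer n ≥ 2 there is a constant C(n) with μ(J₁) ≤ C(n)·μ(J₂) for all n-adic siblings J₁, J₂ ⊆ [−1,1), yet μ is not doubling: for every C > 0 there exist adjacent intervals I₁, I₂ ⊆ [−1,1) of equal positive length with μ(I₁) > C·μ(I₂). -/
open MeasureTheory Set
open scoped ENNReal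

/-- The density is comparable to the identity on `(0, 1)`. -/
lemma staircase_bounds {f : ℝ → ℝ}
    (hf2 : ∀ k : ℕ, 1 ≤ k → ∀ x ∈ Set.Ico ((2:ℝ) ^ (-(k:ℤ))) ((2:ℝ) ^ (-(k:ℤ) + 1)),
      f x = (2:ℝ) ^ (-(k:ℤ))) {x : ℝ} (hx : x ∈ Set.Ioo (0:ℝ) 1) :
    x / 2 ≤ f x ∧ f x ≤ x := by
  obtain ⟨n, hn⟩ := exists_mem_Ico_zpow hx.1 (one_lt_two : (1:ℝ) < 2)
  have hn0 : n < 0 := by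
    by_contra! h
    have := one_le_zpow₀ (one_le_two : (1:ℝ) ≤ 2) h
    linarith [hn.1, hx.2]
  obtain ⟨k, rfl⟩ : ∃ k : ℕ, n = -(k:ℤ) := ⟨n.natAbs, by omega⟩
  rw [hf2 k (by omega) x hn]
  have h2 := hn.2
  rw [zpow_add₀ two_ne_zero, zpow_one] at h2
  exact ⟨by linarith, hn.1⟩

lemma withDensity_restrict_Ico {f : ℝ → ℝ} {c d a b : ℝ} (ha : c ≤ a) (hb : b ≤ d) :
    ((volume.restrict (Set.Ico c d)).withDensity fun x => ENNReal.ofReal (f x)) (Set.Ico a b) =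
      ∫⁻ x in Set.Ioo a b, ENNReal.ofReal (f x) := by
  rw [withDensity_apply _ measurableSet_Ico, Measure.restrict_restrict measurableSet_Ico,
    inter_eq_left.2 (Set.Ico_subset_Ico ha hb)]
  exact setLIntegral_congr Ioo_ae_eq_Ico.symm

lemma setLIntegral_Ioo_le {f : ℝ → ℝ} {a b M : ℝ} (hM : 0 ≤ M)
    (h : ∀ x ∈ Set.Ioo a b, f x ≤ M) :
    ∫⁻ x in Set.Ioo a b, ENNReal.ofReal (f x) ≤ ENNReal.ofReal (M * (b - a)) := by
  calc _ ≤ ∫⁻ _ in Set.Ioo a b, ENNReal.ofReal M :=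
        setLIntegral_mono' measurableSet_Ioo fun x hx => ENNReal.ofReal_le_ofReal (h x hx)
    _ = _ := by rw [setLIntegral_const, Real.volume_Ioo, ENNReal.ofReal_mul hM]

lemma le_setLIntegral_Ioo {f : ℝ → ℝ} {a b M : ℝ} (hM : 0 ≤ M)
    (h : ∀ x ∈ Set.Ioo a b, M ≤ f x) :
    ENNReal.ofReal (M * (b - a)) ≤ ∫⁻ x in Set.Ioo a b, ENNReal.ofReal (f x) := by
  calc _ = ∫⁻ _ in Set.Ioo a b, ENNReal.ofReal M := by
        rw [setLIntegral_const, Real.volume_Ioo, ENNReal.ofReal_mul hM]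
    _ ≤ _ := setLIntegral_mono' measurableSet_Ioo fun x hx => ENNReal.ofReal_le_ofReal (h x hx)

/-- motivating example, staircase: the measure on `[-1,1)` with density `1`
on `[-1,0)` and `2^{-k}` on `[2^{-k}, 2^{-k+1})` for each `k ≥ 1` is `n`-adic doubling for
every `n ≥ 2` yet not doubling. -/
theorem motivating_example_staircase_density
    (f : ℝ → ℝ) (hf : Measurable f)
    (hf1 : ∀ x ∈ Set.Ico (-1:ℝ) 0, f x = 1)
    (hf2 : ∀ k : ℕ, 1 ≤ k → ∀ x ∈ Set.Ico ((2:ℝ) ^ (-(k:ℤ))) ((2:ℝ) ^ (-(k:ℤ) + 1)),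
      f x = (2:ℝ) ^ (-(k:ℤ)))
    (μ : Measure ℝ)
    (hμ : μ = (volume.restrict (Set.Ico (-1) 1)).withDensity
      fun x => ENNReal.ofReal (f x)) :
    (∀ n : ℕ, 2 ≤ n → ∃ C : ℝ, 0 < C ∧
      ∀ J₁ J₂ : Set ℝ, NAdicSiblings n J₁ J₂ →
        J₁ ⊆ Set.Ico (-1) 1 → J₂ ⊆ Set.Ico (-1) 1 →
        μ J₁ ≤ ENNReal.ofReal C * μ J₂) ∧
    (∀ C : ℝ, 0 < C → ∃ I₁ I₂ : Set ℝ, AdjacentPair I₁ I₂ ∧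
      I₁ ⊆ Set.Ico (-1) 1 ∧ I₂ ⊆ Set.Ico (-1) 1 ∧ ENNReal.ofReal C * μ I₂ < μ I₁) := by
  have hI {a b : ℝ} (ha : -1 ≤ a) (hb : b ≤ 1) :
      μ (Set.Ico a b) = ∫⁻ x in Set.Ioo a b, ENNReal.ofReal (f x) := by
    rw [hμ, withDensity_restrict_Ico ha hb]
  have hbd {x : ℝ} (hx : x ∈ Set.Ioo (0:ℝ) 1) := staircase_bounds hf2 hx
  refine ⟨fun n hn => ⟨8 * (n + 1), by positivity, ?_⟩, fun C hC => ?_⟩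
  · rintro _ _ ⟨m, k₁, k₂, k, rfl, rfl, h₁, h₂⟩ hd₁ hd₂
    have hn0 : (0:ℝ) < n := by positivity
    have hp : (0:ℝ) < (n:ℝ) ^ (m + 1) := by positivity
    obtain ⟨l, hl⟩ : ∃ l : ℝ, l = 1 / (n:ℝ) ^ (m + 1) := ⟨_, rfl⟩
    have hl0 : 0 < l := by rw [hl]; positivity
    have hJ (j : ℤ) : nadicI n (m + 1) j = Set.Ico ((j - 1) * l) ((j - 1) * l + l) := by
      unfold nadicI
      congr 1 <;> rw [hl] <;> ring
    have hP : nadicI n m k = Set.Ico ((k - 1) * (n * l)) (k * (n * l)) := by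
      have : n * l = 1 / (n:ℝ) ^ m := by
        rw [hl, zpow_add₀ hn0.ne', zpow_one]
        field_simp
      unfold nadicI
      congr 1 <;> rw [this] <;> ring
    rw [hJ, hP, Set.Ico_subset_Ico_iff (by linarith)] at h₁ h₂
    rw [hJ, Set.Ico_subset_Ico_iff (by linarith)] at hd₁ hd₂
    rw [hJ, hJ, hI hd₁.1 hd₁.2, hI hd₂.1 hd₂.2]
    generalize (k₁ - 1 : ℝ) * l = a₁ at *
    generalize (k₂ - 1 : ℝ) * l = a₂ at *
    have hnl : 0 < n * l := by positivity
    rcases le_or_gt k 0 with hk | hk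
    · have hk' : (k:ℝ) * (n * l) ≤ 0 :=
        mul_nonpos_of_nonpos_of_nonneg (by exact_mod_cast hk) hnl.le
      have hone {a : ℝ} (ha : -1 ≤ a) (hb : a + l ≤ 0) (x) (hx : x ∈ Set.Ioo a (a + l)) :
          f x = 1 := hf1 x ⟨by linarith [hx.1], by linarith [hx.2]⟩
      refine (setLIntegral_Ioo_le zero_le_one
        fun x hx => (hone hd₁.1 (by linarith) x hx).le).trans ?_
      refine le_trans ?_ (mul_le_mul_right (le_setLIntegral_Ioo zero_le_one
        fun x hx => (hone hd₂.1 (by linarith) x hx).ge) _)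
      rw [← ENNReal.ofReal_mul (by positivity)]
      apply ENNReal.ofReal_le_ofReal
      nlinarith
    · have hk' : 0 ≤ ((k:ℝ) - 1) * (n * l) :=
        mul_nonneg (by have : (1:ℝ) ≤ k := by exact_mod_cast hk
                       linarith) hnl.le
      have h12 : a₁ + l ≤ a₂ + n * l := by linarith
      have ha₁ : 0 ≤ a₁ := by linarith
      have ha₂ : 0 ≤ a₂ := by linarith
      refine (setLIntegral_Ioo_le (M := a₁ + l) (by linarith) fun x hx =>
        (hbd ⟨by linarith [hx.1], by linarith [hx.2]⟩).2.trans hx.2.le).trans ?_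
      have hlow : ENNReal.ofReal ((a₂ + l / 2) / 2 * (a₂ + l - (a₂ + l / 2))) ≤
          ∫⁻ x in Set.Ioo a₂ (a₂ + l), ENNReal.ofReal (f x) :=
        (le_setLIntegral_Ioo (by linarith) fun x hx => le_trans (by linarith [hx.1])
          (hbd ⟨by linarith [hx.1], by linarith [hx.2]⟩).1).trans
          (lintegral_mono_set (Set.Ioo_subset_Ioo_left (by linarith)))
      refine le_trans ?_ (mul_le_mul_right hlow _)
      rw [← ENNReal.ofReal_mul (by positivity)]
      apply ENNReal.ofReal_le_ofReal
      have key : a₁ + l ≤ (n + 1) * (2 * a₂ + l) := by nlinarith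
      nlinarith [mul_le_mul_of_nonneg_right key hl0.le]
  · obtain ⟨l, hl⟩ : ∃ l : ℝ, l = 1 / (C + 1) := ⟨_, rfl⟩
    have hl0 : 0 < l := by rw [hl]; positivity
    have hCl : C * l + l = 1 := by rw [hl]; field_simp
    have hl1 : l < 1 := by linarith [mul_pos hC hl0]
    refine ⟨Set.Ico (0 - l) 0, Set.Ico 0 (0 + l), ⟨0, l, hl0, Or.inl ⟨rfl, rfl⟩⟩,
      Set.Ico_subset_Ico (by linarith) (by linarith),
      Set.Ico_subset_Ico (by linarith) (by linarith), ?_⟩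
    rw [hI (by linarith) (by linarith), hI (by linarith) (by linarith)]
    refine lt_of_le_of_lt (mul_le_mul_right (setLIntegral_Ioo_le (M := l) hl0.le fun x hx =>
      (hbd ⟨hx.1, by linarith [hx.2]⟩).2.trans (by linarith [hx.2])) _) ?_
    refine lt_of_lt_of_le ?_ (le_setLIntegral_Ioo zero_le_one fun x hx =>
      (hf1 x ⟨by linarith [hx.1], hx.2⟩).ge)
    rw [← ENNReal.ofReal_mul hC.le, ENNReal.ofReal_lt_ofReal_iff (by linarith)]
    nlinarith
end
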